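/- Let Ω ⊆ ℝⁿ be open and bounded, Ω± = Ω∩{±xₙ>0}, Γ = Ω∩{xₙ=0}, and fix [λ,Λ] ⊆ (0,∞) and η > 0. Assume: (H₋) H₋ is a locally Lipschitz first-order operator on Ω₋∪Γ that is degenerate elliptic (nondecreasing in z), quasi-convex, and has bounded sub-level sets; (H₊) H₊(M,p,z,x) = F(M,p,z) + f(z,x) is degenerate elliptic, where F : Sym_n(ℝ)×ℝⁿ×ℝ → ℝ is continuous, translation invariant (independent of x), and uniformly elliptic with respect to [λ,Λ], and f ∈ C(ℝ×(Ω₊∪Γ)) is increasing in z. Let u, v ∈ C(closure(Ω)) ∩ C^{0,1}(Ω₋), where u is a viscosity sub-solution of {H₋u + η ≤ 0 in Ω₋∪Γ, H₊u + η ≤ 0 in Ω₊} and v is a viscosity super-solution of {H₋v ≥ 0 in Ω₋∪Γ, H₊v ≥ 0 in Ω₊}. If u ≤ v on ∂Ω, then u ≤ v in Ω. -/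

import Mathlib

open Metric Set Filter Topology Bornology

noncomputable section

abbrev Euc (n : ℕ) := EuclideanSpace ℝ (Fin n)

/-- Hessian matrix of a function at a point (second iterated Fréchet derivative,
a purely local notion). -/
def hessianMatrix {n : ℕ} (φ : Euc n → ℝ) (x : Euc n) : Matrix (Fin n) (Fin n) ℝ :=
  Matrix.of fun i j =>
    iteratedFDeriv ℝ 2 φ x ![EuclideanSpace.single i (1 : ℝ), EuclideanSpace.single j (1 : ℝ)]

/-- Evaluation of a second-order operator on a C² function. -/
def evalOp2 {n : ℕ} (H : Matrix (Fin n) (Fin n) ℝ → Euc n → ℝ → Euc n → ℝ)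
    (φ : Euc n → ℝ) (x : Euc n) : ℝ :=
  H (hessianMatrix φ x) (gradient φ x) (φ x) x

/-- Evaluation of a first-order operator on a differentiable function. -/
def evalOp1 {n : ℕ} (H : Euc n → ℝ → Euc n → ℝ) (φ : Euc n → ℝ) (x : Euc n) : ℝ :=
  H (gradient φ x) (φ x) x

/-- Degenerate ellipticity of a second-order operator on `S`. -/
def DegElliptic2 {n : ℕ} (S : Set (Euc n))
    (H : Matrix (Fin n) (Fin n) ℝ → Euc n → ℝ → Euc n → ℝ) : Prop :=
  ∀ M₁ M₂ : Matrix (Fin n) (Fin n) ℝ, ∀ p : Euc n, ∀ z₁ z₂ : ℝ, ∀ x ∈ S,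
    (M₁ - M₂).PosSemidef → z₁ ≤ z₂ → H M₁ p z₁ x ≤ H M₂ p z₂ x

/-- A first-order operator is degenerate elliptic (nondecreasing in `z`) on `S`. -/
def DegElliptic1 {n : ℕ} (S : Set (Euc n)) (H : Euc n → ℝ → Euc n → ℝ) : Prop :=
  ∀ p : Euc n, ∀ z₁ z₂ : ℝ, ∀ x ∈ S, z₁ ≤ z₂ → H p z₁ x ≤ H p z₂ x

/-- A first-order operator has bounded sub-level sets on `S`. -/
def BoundedSublevels1 {n : ℕ} (S : Set (Euc n)) (H : Euc n → ℝ → Euc n → ℝ) : Prop :=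
  ∀ z c : ℝ, Bornology.IsBounded {p : Euc n | ∃ x ∈ S, H p z x ≤ c}

/-- The set of symmetric matrices `A` with `λ I ≤ A ≤ Λ I`. -/
def pucciSet (n : ℕ) (l L : ℝ) : Set (Matrix (Fin n) (Fin n) ℝ) :=
  {A | (A - l • (1 : Matrix (Fin n) (Fin n) ℝ)).PosSemidef ∧
       ((L • (1 : Matrix (Fin n) (Fin n) ℝ)) - A).PosSemidef}

/-- Pucci maximal operator `𝓜⁺_{λ,Λ}`. -/
def pucciPlus {n : ℕ} (l L : ℝ) (M : Matrix (Fin n) (Fin n) ℝ) : ℝ :=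
  sSup ((fun A : Matrix (Fin n) (Fin n) ℝ => -(A * M).trace) '' pucciSet n l L)

/-- Pucci minimal operator `𝓜⁻_{λ,Λ}`. -/
def pucciMinus {n : ℕ} (l L : ℝ) (M : Matrix (Fin n) (Fin n) ℝ) : ℝ :=
  sInf ((fun A : Matrix (Fin n) (Fin n) ℝ => -(A * M).trace) '' pucciSet n l L)

/-- Uniform ellipticity of a translation invariant operator `F` w.r.t. `[λ, Λ]`. -/
def UnifEllipticF {n : ℕ} (l L : ℝ) (F : Matrix (Fin n) (Fin n) ℝ → Euc n → ℝ → ℝ) : Prop :=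
  ∀ M₁ M₂ : Matrix (Fin n) (Fin n) ℝ, ∀ p₁ p₂ : Euc n, ∀ z₁ z₂ : ℝ,
    pucciMinus l L (M₂ - M₁) - L * ‖p₂ - p₁‖ - L * max (-(z₂ - z₁)) 0
        ≤ F M₂ p₂ z₂ - F M₁ p₁ z₁ ∧
      F M₂ p₂ z₂ - F M₁ p₁ z₁
        ≤ pucciPlus l L (M₂ - M₁) + L * ‖p₂ - p₁‖ + L * max (z₂ - z₁) 0

/-- A first-order operator is locally Lipschitz on `ℝⁿ × ℝ × S`. -/
def LocallyLipschitzOp1 {n : ℕ} (S : Set (Euc n)) (H : Euc n → ℝ → Euc n → ℝ) : Prop :=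
  ∀ q : Euc n × ℝ × Euc n, q.2.2 ∈ S →
    ∃ K : NNReal, ∃ t ∈ 𝓝[univ ×ˢ univ ×ˢ S] q,
      LipschitzOnWith K (fun q' : Euc n × ℝ × Euc n => H q'.1 q'.2.1 q'.2.2) t

/-- A first-order operator is quasi-convex: its sub-level sets in `(p, z)` are convex. -/
def QuasiConvex1 {n : ℕ} (S : Set (Euc n)) (H : Euc n → ℝ → Euc n → ℝ) : Prop :=
  ∀ x ∈ S, ∀ c : ℝ, Convex ℝ {q : Euc n × ℝ | H q.1 q.2 x ≤ c}

/-- `φ` is an admissible C² test function touching `u` from above at `x₀` on `ball x₀ r ⊆ Ω`. -/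
def SubTest {n : ℕ} (Ω : Set (Euc n)) (u : Euc n → ℝ) (x₀ : Euc n)
    (φ : Euc n → ℝ) (r : ℝ) : Prop :=
  0 < r ∧ ball x₀ r ⊆ Ω ∧ ContDiffOn ℝ 2 φ (ball x₀ r) ∧
    (∀ x ∈ ball x₀ r, u x ≤ φ x) ∧ u x₀ = φ x₀

/-- `φ` is an admissible C² test function touching `u` from below at `x₀` on `ball x₀ r ⊆ Ω`. -/
def SupTest {n : ℕ} (Ω : Set (Euc n)) (u : Euc n → ℝ) (x₀ : Euc n)
    (φ : Euc n → ℝ) (r : ℝ) : Prop :=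
  0 < r ∧ ball x₀ r ⊆ Ω ∧ ContDiffOn ℝ 2 φ (ball x₀ r) ∧
    (∀ x ∈ ball x₀ r, φ x ≤ u x) ∧ u x₀ = φ x₀

open scoped RealInnerProductSpace

section Jets

variable {E : Type*} [NormedAddCommGroup E] [InnerProductSpace ℝ E]

/-- `(b, T)` is a second order superjet of `u` at `x`. -/
def Superjet (u : E → ℝ) (x b : E) (T : E →L[ℝ] E) : Prop :=
  (∀ y z, ⟪T y, z⟫ = ⟪y, T z⟫) ∧
    ∀ᶠ y in 𝓝 x, u y ≤ u x + ⟪b, y - x⟫ + ⟪T (y - x), y - x⟫ / 2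

/-- The symmetric operator `α I - β e ⊗ e`. -/
def quadOp (e : E) (α β : ℝ) : E →L[ℝ] E :=
  α • ContinuousLinearMap.id ℝ E - β • (innerSL ℝ e).smulRight e

lemma quadOp_apply (e : E) (α β : ℝ) (y : E) :
    quadOp e α β y = α • y - (β * ⟪e, y⟫) • e := by
  simp [quadOp, smul_smul]

lemma quadOp_symm (e : E) (α β : ℝ) (y z : E) :
    ⟪quadOp e α β y, z⟫ = ⟪y, quadOp e α β z⟫ := by
  simp only [quadOp_apply, inner_sub_left, inner_sub_right, real_inner_smul_left,
    real_inner_smul_right, real_inner_comm e]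
  ring

lemma quadOp_inner (e : E) (α β : ℝ) (y : E) :
    ⟪quadOp e α β y, y⟫ = α * ‖y‖ ^ 2 - β * ⟪e, y⟫ ^ 2 := by
  simp only [quadOp_apply, inner_sub_left, real_inner_smul_left, real_inner_self_eq_norm_sq]
  ring

lemma Superjet.of_isLocalMax {u : E → ℝ} {x : E} (h : IsLocalMax u x) : Superjet u x 0 0 := by
  refine ⟨by simp, ?_⟩
  filter_upwards [h] with y hy
  simpa using hy

lemma Superjet.congr {u v : E → ℝ} {x b : E} {T : E →L[ℝ] E} (h : Superjet u x b T)
    (huv : u =ᶠ[𝓝 x] v) : Superjet v x b T := by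
  refine ⟨h.1, ?_⟩
  filter_upwards [h.2, huv] with y hy hy'
  rw [← hy', ← huv.eq_of_nhds]
  exact hy

/-- Adding a quadratic polynomial to a function shifts its superjets. -/
lemma Superjet.add_quad {u : E → ℝ} {x b : E} {T : E →L[ℝ] E} (e c z : E) (α β : ℝ)
    (h : Superjet (fun y => u y -
      (⟪c, y⟫ + α / 2 * ‖y - z‖ ^ 2 - β / 2 * ⟪e, y - z⟫ ^ 2)) x b T) :
    Superjet u x (b + (c + α • (x - z) - (β * ⟪e, x - z⟫) • e)) (T + quadOp e α β) := by
  refine ⟨fun y z => ?_, ?_⟩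
  · simp only [add_apply, inner_add_left, inner_add_right, h.1 y z, quadOp_symm]
  · filter_upwards [h.2] with y hy
    obtain ⟨k, rfl⟩ : ∃ k, y = x + k := ⟨y - x, by abel⟩
    obtain ⟨m, rfl⟩ : ∃ m, x = z + m := ⟨x - z, by abel⟩
    have e1 : z + m + k - z = m + k := by abel
    simp only [add_apply, inner_add_left, quadOp_inner, add_sub_cancel_left, e1,
      inner_sub_left, real_inner_smul_left] at hy ⊢
    simp only [inner_add_right, norm_add_sq_real] at hy ⊢
    nlinarith [hy]

lemma Superjet.of_quad {u : E → ℝ} {x : E} (e c z : E) (α β : ℝ)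
    (h : IsLocalMax (fun y => u y -
      (⟪c, y⟫ + α / 2 * ‖y - z‖ ^ 2 - β / 2 * ⟪e, y - z⟫ ^ 2)) x) :
    Superjet u x (c + α • (x - z) - (β * ⟪e, x - z⟫) • e) (quadOp e α β) := by
  simpa using (Superjet.of_isLocalMax h).add_quad e c z α β

/-- Quantitative uniform ellipticity along the operators `α I - β e ⊗ e`. -/
def Ell (e : E) (lam C : ℝ) (G : (E →L[ℝ] E) → E → ℝ) : Prop :=
  ∀ T p q, ∀ α β : ℝ, 0 ≤ α → 0 ≤ β →
    G T p - C * (α + ‖q‖) + lam * β ≤ G (T + quadOp e α β) (p + q)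

lemma Ell.mirror {e : E} {lam C : ℝ} {G : (E →L[ℝ] E) → E → ℝ} (h : Ell e lam C G) :
    Ell e lam C (fun T p => -G (-T) (-p)) := by
  intro T p q α β hα hβ
  have := h (-(T + quadOp e α β)) (-(p + q)) q α β hα hβ
  have e1 : -(T + quadOp e α β) + quadOp e α β = -T := by abel
  have e2 : -(p + q) + q = -p := by abel
  rw [e1, e2] at this
  linarith

/-- Near-maximizers of `u x + w y` with `x` close to `y` concentrate at the strict maximum. -/
lemma strict_doubling {u w : E → ℝ} {K : Set E} (hK : IsCompact K)
    (hw : ContinuousOn w K) {z : E} {M κ ρ : ℝ} (hκ : 0 < κ) (hρ : 0 < ρ)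
    (h : ∀ y ∈ K, u y + w y ≤ M - κ * ‖y - z‖ ^ 2) :
    ∃ δ > 0, δ ≤ ρ ∧ ∀ x ∈ K, ∀ y ∈ K, ‖x - y‖ ≤ δ → M - δ ≤ u x + w y → ‖x - z‖ < ρ := by
  have hu := hK.uniformContinuousOn_of_continuous hw
  rw [Metric.uniformContinuousOn_iff] at hu
  obtain ⟨d, hd, hd'⟩ := hu (κ * ρ ^ 2 / 2) (by positivity)
  refine ⟨min (min ρ (d / 2)) (κ * ρ ^ 2 / 3), by positivity,
    (min_le_left _ _).trans (min_le_left _ _), fun x hx y hy hxy hM => ?_⟩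
  have h1 : ‖x - y‖ < d := by
    have : ‖x - y‖ ≤ d / 2 := hxy.trans ((min_le_left _ _).trans (min_le_right _ _))
    linarith
  have h2 := hd' x hx y hy (by rwa [dist_eq_norm])
  rw [Real.dist_eq, abs_lt] at h2
  have h3 := h x hx
  have h4 : min (min ρ (d / 2)) (κ * ρ ^ 2 / 3) ≤ κ * ρ ^ 2 / 3 := min_le_right _ _
  have h5 : κ * ‖x - z‖ ^ 2 < κ * ρ ^ 2 := by nlinarith
  exact lt_of_pow_lt_pow_left₀ 2 hρ.le (lt_of_mul_lt_mul_left h5 hκ.le)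

end Jets

section FirstOrder

variable {E : Type*} [NormedAddCommGroup E] [InnerProductSpace ℝ E]

lemma doubling_interior [FiniteDimensional ℝ E] {u w : E → ℝ} (hu : Continuous u)
    (hw : Continuous w) {z : E} {r κ ρ : ℝ} (hr : 0 < r) (hκ : 0 < κ) (hρ : 0 < ρ)
    (h : ∀ y ∈ closedBall z r, u y + w y ≤ u z + w z - κ * ‖y - z‖ ^ 2) :
    ∃ a > 0, ∃ ε > 0, ∀ p : E, ‖p‖ < ε → ∀ y ∈ closedBall z r, ∀ y' ∈ closedBall z r,
      u z + w z - ⟪p, z⟫ ≤ u y + w y' - a * ‖y - y'‖ ^ 2 - ⟪p, y + y'⟫ / 2 →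
      ‖y - z‖ < ρ ∧ ‖y' - z‖ < ρ := by
  have hK : IsCompact (closedBall z r) := isCompact_closedBall z r
  obtain ⟨δ, hδ, hδρ, H⟩ := strict_doubling hK hw.continuousOn hκ (half_pos hρ) h
  obtain ⟨B1, hB1⟩ := hK.exists_bound_of_continuousOn hu.continuousOn
  obtain ⟨B2, hB2⟩ := hK.exists_bound_of_continuousOn hw.continuousOn
  have hz : z ∈ closedBall z r := mem_closedBall_self hr.le
  have hB1' : 0 ≤ B1 := (norm_nonneg _).trans (hB1 z hz)
  have hB2' : 0 ≤ B2 := (norm_nonneg _).trans (hB2 z hz)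
  refine ⟨(2 * B1 + 2 * B2 + δ) / δ ^ 2, by positivity, δ / r, by positivity, ?_⟩
  intro p hp y hy y' hy' hle
  have hyz : ‖y - z‖ ≤ r := by simpa [dist_eq_norm] using hy
  have hyz' : ‖y' - z‖ ≤ r := by simpa [dist_eq_norm] using hy'
  have hpr : ‖p‖ * r ≤ δ := ((lt_div_iff₀ hr).1 hp).le
  have h1 : ⟪p, z⟫ - ⟪p, y + y'⟫ / 2 ≤ δ := by
    have e1 := neg_le_of_abs_le (abs_real_inner_le_norm p (y - z))
    have e2 := neg_le_of_abs_le (abs_real_inner_le_norm p (y' - z))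
    have e3 := mul_le_mul_of_nonneg_left hyz (norm_nonneg p)
    have e4 := mul_le_mul_of_nonneg_left hyz' (norm_nonneg p)
    rw [inner_sub_right] at e1 e2
    rw [inner_add_right]
    linarith
  have hpos : 0 ≤ (2 * B1 + 2 * B2 + δ) / δ ^ 2 * ‖y - y'‖ ^ 2 := by positivity
  have hle2 : (2 * B1 + 2 * B2 + δ) / δ ^ 2 * ‖y - y'‖ ^ 2 ≤ 2 * B1 + 2 * B2 + δ := by
    have a1 := abs_le.1 (hB1 y hy)
    have a2 := abs_le.1 (hB1 z hz)
    have a3 := abs_le.1 (hB2 y' hy')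
    have a4 := abs_le.1 (hB2 z hz)
    linarith
  have hyy : ‖y - y'‖ ≤ δ := by
    rw [div_mul_eq_mul_div, div_le_iff₀ (by positivity)] at hle2
    exact le_of_sq_le_sq (le_of_mul_le_mul_left hle2 (by positivity)) hδ.le
  have h2 := H y hy y' hy' hyy (by linarith)
  refine ⟨by linarith, ?_⟩
  calc ‖y' - z‖ = ‖(y - z) - (y - y')‖ := by congr 1; abel
    _ ≤ ‖y - z‖ + ‖y - y'‖ := norm_sub_le _ _
    _ < ρ := by linarith

/-- Doubling of variables for a first order operator at an interior maximum. -/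
lemma firstOrder_interior [FiniteDimensional ℝ E] {u w : E → ℝ} (hu : Continuous u)
    (hw : Continuous w) {z : E} {r R A B : ℝ} (hr : 0 < r) {h : E → ℝ} (hh : Continuous h)
    (hmax : ∀ y ∈ closedBall z r, u y + w y ≤ u z + w z)
    (hju : ∀ x ∈ ball z r, ∀ b T, Superjet u x b T → ‖b‖ ≤ R ∧ h b ≤ A)
    (hjw : ∀ x ∈ ball z r, ∀ b T, Superjet w x b T → B ≤ h (-b)) : B ≤ A := by
  by_contra! hAB
  have huc := (isCompact_closedBall (0 : E) (R + 1)).uniformContinuousOn_of_continuous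
    hh.continuousOn
  rw [Metric.uniformContinuousOn_iff] at huc
  obtain ⟨δ, hδ, H⟩ := huc (B - A) (by linarith)
  obtain ⟨κ, hκ, hκ1, hκ2⟩ : ∃ κ > 0, 2 * κ * r < δ ∧ 2 * κ * r < 1 := by
    refine ⟨min δ 1 / (4 * r), by positivity, ?_, ?_⟩
    · have : 2 * (min δ 1 / (4 * r)) * r = min δ 1 / 2 := by field_simp; ring
      rw [this]; linarith [min_le_left δ 1]
    · have : 2 * (min δ 1 / (4 * r)) * r = min δ 1 / 2 := by field_simp; ring
      rw [this]; linarith [min_le_right δ 1]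
  set U : E → ℝ := fun y => u y - κ * ‖y - z‖ ^ 2 with hU
  have hUc : Continuous U := by fun_prop
  obtain ⟨a, ha, ε, hε, Hd⟩ := doubling_interior (u := U) (w := w) hUc hw hr hκ hr
    (by intro y hy; have := hmax y hy; simp only [hU, sub_self, norm_zero]; linarith)
  have hK : IsCompact (closedBall z r ×ˢ closedBall z r) :=
    (isCompact_closedBall z r).prod (isCompact_closedBall z r)
  have hz : z ∈ closedBall z r := mem_closedBall_self hr.le
  obtain ⟨⟨x, y⟩, ⟨hx, hy⟩, hxy⟩ := hK.exists_isMaxOn ⟨(z, z), hz, hz⟩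
    (f := fun q : E × E => U q.1 + w q.2 - a * ‖q.1 - q.2‖ ^ 2) (by fun_prop)
  rw [isMaxOn_iff] at hxy
  simp only [mem_prod, Prod.forall, and_imp] at hxy hx hy
  obtain ⟨hxi, hyi⟩ := Hd 0 (by simpa using hε) x hx y hy (by simpa using hxy z z hz hz)
  have hxi' : x ∈ ball z r := by simpa [dist_eq_norm] using hxi
  have hyi' : y ∈ ball z r := by simpa [dist_eq_norm] using hyi
  have j1 := Superjet.of_quad (u := U) (x := x) 0 0 y (2 * a) 0 (by
    filter_upwards [isOpen_ball.mem_nhds hxi'] with x' hx'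
    have := hxy x' y (ball_subset_closedBall hx') hy
    simp only [inner_zero_left]; linarith)
  have j2 := Superjet.of_quad (u := w) (x := y) 0 0 x (2 * a) 0 (by
    filter_upwards [isOpen_ball.mem_nhds hyi'] with y' hy'
    have := hxy x y' hx (ball_subset_closedBall hy')
    rw [norm_sub_rev x y', norm_sub_rev x y] at this
    simp only [inner_zero_left]; linarith)
  have j3 := Superjet.add_quad (u := u) (x := x) 0 0 z (2 * κ) 0 (by
    convert j1 using 1
    funext x'; simp only [hU, inner_zero_left]; ring)
  obtain ⟨n1, l1⟩ := hju x hxi' _ _ j3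
  have l2 := hjw y hyi' _ _ j2
  simp only [inner_zero_left, mul_zero, zero_smul, zero_add, sub_zero] at n1 l1 l2
  have e1 : -((2 * a) • (y - x)) = (2 * a) • (x - y) := by rw [← smul_neg, neg_sub]
  rw [e1] at l2
  set p := (2 * a) • (x - y)
  have hq : ‖(2 * κ) • (x - z)‖ ≤ 2 * κ * r := by
    rw [norm_smul, Real.norm_of_nonneg (by positivity)]
    gcongr
  have hp : ‖p‖ ≤ R + 1 := by
    have := norm_sub_le (p + (2 * κ) • (x - z)) ((2 * κ) • (x - z))
    rw [add_sub_cancel_right] at this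
    linarith
  have := H p (by simpa using hp) (p + (2 * κ) • (x - z)) (by simpa using by linarith)
    (by rw [dist_eq_norm]; simp only [sub_add_cancel_left, norm_neg]; linarith)
  rw [Real.dist_eq, abs_lt] at this
  linarith

end FirstOrder

section Insertion

variable {E : Type*} [NormedAddCommGroup E] [InnerProductSpace ℝ E]

lemma sq_norm_segment (p q y : E) (θ : ℝ) :
    ‖((1 - θ) • p + θ • q) - y‖ ^ 2 =
      (1 - θ) * ‖p - y‖ ^ 2 + θ * ‖q - y‖ ^ 2 - θ * (1 - θ) * ‖q - p‖ ^ 2 := by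
  have e1 : ((1 - θ) • p + θ • q) - y = (1 - θ) • (p - y) + θ • (q - y) := by module
  have e2 : q - p = (q - y) - (p - y) := by abel
  rw [e1, e2, norm_add_sq_real, norm_sub_sq_real (q - y), norm_smul, norm_smul, mul_pow, mul_pow,
    real_inner_smul_left, real_inner_smul_right, Real.norm_eq_abs, Real.norm_eq_abs, sq_abs,
    sq_abs, real_inner_comm (q - y)]
  ring

/-- Lasry–Lions regularization: a `C^{1,1}` function trapped between the paraboloid hulls
of `u` on a compact set. -/
lemma exists_insertion [FiniteDimensional ℝ E] {u : E → ℝ} (hu : Continuous u) {K : Set E}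
    (hK : IsCompact K) (hKne : K.Nonempty) {a : ℝ} (ha : 0 < a) :
    ∃ (g : E → ℝ) (ξ : E → E),
      (∀ x y, |g y - g x - ⟪ξ x, y - x⟫| ≤ 2 * a * ‖y - x‖ ^ 2) ∧
      (∀ x, ∀ y ∈ K, u y - 2 * a * ‖x - y‖ ^ 2 ≤ g x) ∧
      (∀ x z s, (∀ y ∈ K, u y - a * ‖z - y‖ ^ 2 ≤ s) → g x ≤ s + 2 * a * ‖x - z‖ ^ 2) := by
  set c : E → ℝ := fun z => sSup ((fun y => u y - a * ‖z - y‖ ^ 2) '' K) with hc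
  have hcc : Continuous c :=
    IsCompact.continuous_sSup (f := fun z y => u y - a * ‖z - y‖ ^ 2) hK (by fun_prop)
  have hcle : ∀ z, ∀ y ∈ K, u y - a * ‖z - y‖ ^ 2 ≤ c z := fun z y hy =>
    le_csSup (hK.image (by fun_prop)).bddAbove (mem_image_of_mem _ hy)
  have hcub : ∀ z s, (∀ y ∈ K, u y - a * ‖z - y‖ ^ 2 ≤ s) → c z ≤ s := by
    intro z s h
    refine csSup_le (hKne.image _) ?_
    rintro _ ⟨y, hy, rfl⟩
    exact h y hy
  have hmin : ∀ x, ∃ z, ∀ z', c z + 2 * a * ‖x - z‖ ^ 2 ≤ c z' + 2 * a * ‖x - z'‖ ^ 2 := by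
    intro x
    obtain ⟨y0, hy0⟩ := hKne
    refine Continuous.exists_forall_le (β := E) (f := fun z => c z + 2 * a * ‖x - z‖ ^ 2)
      (by fun_prop) ?_
    have h1 : Tendsto (fun z : E => ‖x - z‖) (cocompact E) atTop := by
      have := tendsto_norm_cocompact_atTop (E := E)
      have h2 : Tendsto (fun z : E => x - z) (cocompact E) (cocompact E) :=
        (Homeomorph.subLeft x).isClosedEmbedding.tendsto_cocompact
      exact this.comp h2
    have h2 : Tendsto (fun z : E => u y0 - 3 * a * ‖x - y0‖ ^ 2 + a / 2 * ‖x - z‖ ^ 2)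
        (cocompact E) atTop :=
      tendsto_atTop_add_const_left _ _
        (((tendsto_pow_atTop two_ne_zero).comp h1).const_mul_atTop (by positivity))
    refine tendsto_atTop_mono (fun z => ?_) h2
    have h3 := hcle z y0 hy0
    have e1 : z - y0 = (x - y0) - (x - z) := by abel
    have h4 : ‖z - y0‖ ≤ ‖x - y0‖ + ‖x - z‖ := by rw [e1]; exact norm_sub_le _ _
    have h5 : ‖z - y0‖ ^ 2 ≤ (‖x - y0‖ + ‖x - z‖) ^ 2 := by gcongr
    have h6 : ‖z - y0‖ ^ 2 ≤ 3 * ‖x - y0‖ ^ 2 + 3 / 2 * ‖x - z‖ ^ 2 := by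
      nlinarith [sq_nonneg (‖x - z‖ - 2 * ‖x - y0‖)]
    nlinarith [mul_le_mul_of_nonneg_left h6 ha.le]
  choose ζ hζ using hmin
  have hstrong : ∀ x z, c (ζ x) + 2 * a * ‖x - ζ x‖ ^ 2 + a * ‖z - ζ x‖ ^ 2 ≤
      c z + 2 * a * ‖x - z‖ ^ 2 := by
    intro x z
    have key : ∀ θ ∈ Ioo (0 : ℝ) 1, c (ζ x) + 2 * a * ‖x - ζ x‖ ^ 2 +
        a * (1 - θ) * ‖z - ζ x‖ ^ 2 ≤ c z + 2 * a * ‖x - z‖ ^ 2 := by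
      rintro θ ⟨h0, h1⟩
      have h2 := hζ x ((1 - θ) • ζ x + θ • z)
      have h3 : c ((1 - θ) • ζ x + θ • z) ≤
          (1 - θ) * c (ζ x) + θ * c z + a * (θ * (1 - θ) * ‖z - ζ x‖ ^ 2) := by
        refine hcub _ _ fun y hy => ?_
        rw [sq_norm_segment]
        have e1 := mul_le_mul_of_nonneg_left (hcle (ζ x) y hy) (by linarith : 0 ≤ 1 - θ)
        have e2 := mul_le_mul_of_nonneg_left (hcle z y hy) h0.le
        linarith
      rw [norm_sub_rev x ((1 - θ) • ζ x + θ • z), sq_norm_segment, norm_sub_rev (ζ x) x,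
        norm_sub_rev z x] at h2
      have h4 : θ * (c (ζ x) + 2 * a * ‖x - ζ x‖ ^ 2 + a * (1 - θ) * ‖z - ζ x‖ ^ 2) ≤
          θ * (c z + 2 * a * ‖x - z‖ ^ 2) := by nlinarith
      exact le_of_mul_le_mul_left h4 h0
    have hlim : Tendsto (fun θ : ℝ => c (ζ x) + 2 * a * ‖x - ζ x‖ ^ 2 +
        a * (1 - θ) * ‖z - ζ x‖ ^ 2) (𝓝[>] 0) (𝓝 (c (ζ x) + 2 * a * ‖x - ζ x‖ ^ 2 +
        a * (1 - 0) * ‖z - ζ x‖ ^ 2)) :=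
      (Continuous.tendsto (by fun_prop) 0).mono_left nhdsWithin_le_nhds
    have := le_of_tendsto hlim (by
      filter_upwards [Ioo_mem_nhdsGT (zero_lt_one' ℝ)] with θ hθ using key θ hθ)
    simpa using this
  refine ⟨fun x => c (ζ x) + 2 * a * ‖x - ζ x‖ ^ 2, fun x => (4 * a) • (x - ζ x), ?_, ?_, ?_⟩
  · intro x y
    have expand : ∀ z, ‖y - z‖ ^ 2 = ‖x - z‖ ^ 2 + 2 * ⟪x - z, y - x⟫ + ‖y - x‖ ^ 2 := by
      intro z
      have e1 : y - z = (x - z) + (y - x) := by abel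
      rw [e1, norm_add_sq_real]
    rw [abs_le, real_inner_smul_left]
    constructor
    · have h1 := hstrong x (ζ y)
      have h2 := expand (ζ y)
      have e1 : x - ζ y = (x - ζ x) - (ζ y - ζ x) := by abel
      have e2 : ⟪x - ζ y, y - x⟫ = ⟪x - ζ x, y - x⟫ - ⟪ζ y - ζ x, y - x⟫ := by
        rw [e1, inner_sub_left]
      have h3 := (abs_le.1 (abs_real_inner_le_norm (ζ y - ζ x) (y - x))).2
      have h4 := mul_le_mul_of_nonneg_left h3 ha.le
      simp only [h2, e2]
      nlinarith [mul_nonneg ha.le (sq_nonneg (‖ζ y - ζ x‖ - 2 * ‖y - x‖))]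
    · have h1 := hζ y (ζ x)
      have h2 := expand (ζ x)
      simp only [h2] at h1 ⊢
      linarith
  · intro x y hy
    have h1 := hcle (ζ x) y hy
    have e1 : ζ x - y = (x - y) - (x - ζ x) := by abel
    have h4 : ‖ζ x - y‖ ≤ ‖x - y‖ + ‖x - ζ x‖ := by rw [e1]; exact norm_sub_le _ _
    have h5 : ‖ζ x - y‖ ^ 2 ≤ (‖x - y‖ + ‖x - ζ x‖) ^ 2 := by gcongr
    have h6 : ‖ζ x - y‖ ^ 2 ≤ 2 * ‖x - y‖ ^ 2 + 2 * ‖x - ζ x‖ ^ 2 := by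
      nlinarith [sq_nonneg (‖x - y‖ - ‖x - ζ x‖)]
    have := mul_le_mul_of_nonneg_left h6 ha.le
    simp only
    linarith
  · intro x z s h
    have := hζ x z
    have := hcub z s h
    simp only
    linarith

variable {g : E → ℝ} {ξ : E → E} {a : ℝ}

lemma lipschitz_of_quadratic_expansion (ha : 0 < a)
    (h : ∀ x y, |g y - g x - ⟪ξ x, y - x⟫| ≤ 2 * a * ‖y - x‖ ^ 2) :
    LipschitzWith (Real.toNNReal (12 * a)) ξ := by
  refine LipschitzWith.of_dist_le_mul fun y x => ?_
  rw [Real.coe_toNNReal _ (by positivity), dist_eq_norm, dist_eq_norm]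
  set d := (1 / (12 * a)) • (ξ y - ξ x) with hd
  have h1 := abs_le.1 (h x y)
  have h2 := abs_le.1 (h y (y + d))
  have h3 := abs_le.1 (h x (y + d))
  have e1 : y + d - x = (y - x) + d := by abel
  rw [e1, inner_add_right] at h3
  rw [add_sub_cancel_left] at h2
  have h4 : ‖(y - x) + d‖ ^ 2 ≤ 2 * ‖y - x‖ ^ 2 + 2 * ‖d‖ ^ 2 := by
    nlinarith [parallelogram_law_with_norm ℝ (y - x) d, sq_nonneg ‖(y - x) - d‖]
  have h5 : ⟪ξ y, d⟫ - ⟪ξ x, d⟫ = 1 / (12 * a) * ‖ξ y - ξ x‖ ^ 2 := by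
    rw [← inner_sub_left, hd, real_inner_smul_right, real_inner_self_eq_norm_sq]
  have h6 : ‖d‖ = 1 / (12 * a) * ‖ξ y - ξ x‖ := by
    rw [hd, norm_smul, Real.norm_of_nonneg (by positivity)]
  have h7 : 1 / (12 * a) * ‖ξ y - ξ x‖ ^ 2 ≤ 6 * a * (‖y - x‖ ^ 2 + ‖d‖ ^ 2) := by
    nlinarith [mul_le_mul_of_nonneg_left h4 ha.le, h1.2, h1.1, h2.2, h3.1, h3.2, h2.1]
  have h8 : ‖ξ y - ξ x‖ ^ 2 ≤ (12 * a * ‖y - x‖) ^ 2 := by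
    rw [h6] at h7
    have e2 : 6 * a * (‖y - x‖ ^ 2 + (1 / (12 * a) * ‖ξ y - ξ x‖) ^ 2) =
      6 * a * ‖y - x‖ ^ 2 + 1 / (24 * a) * ‖ξ y - ξ x‖ ^ 2 := by field_simp; ring
    have e3 : 1 / (12 * a) * ‖ξ y - ξ x‖ ^ 2 =
      1 / (24 * a) * ‖ξ y - ξ x‖ ^ 2 + 1 / (24 * a) * ‖ξ y - ξ x‖ ^ 2 := by field_simp; ring
    have h9 : 1 / (24 * a) * ‖ξ y - ξ x‖ ^ 2 ≤ 6 * a * ‖y - x‖ ^ 2 := by linarith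
    rw [div_mul_eq_mul_div, div_le_iff₀ (by positivity)] at h9
    nlinarith
  exact le_of_sq_le_sq h8 (by positivity)

lemma hasFDerivAt_of_quadratic_expansion
    (h : ∀ x y, |g y - g x - ⟪ξ x, y - x⟫| ≤ 2 * a * ‖y - x‖ ^ 2) (x : E) :
    HasFDerivAt g (innerSL ℝ (ξ x)) x := by
  rw [hasFDerivAt_iff_isLittleO]
  have h1 : (fun y => g y - g x - (innerSL ℝ (ξ x)) (y - x)) =O[𝓝 x]
      fun y => ‖y - x‖ ^ 2 := by
    refine Asymptotics.IsBigO.of_bound (2 * a) (Eventually.of_forall fun y => ?_)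
    rw [Real.norm_eq_abs, Real.norm_of_nonneg (by positivity)]
    exact h x y
  exact h1.trans_isLittleO (Asymptotics.isLittleO_pow_sub_sub x one_lt_two)

/-- Second order Taylor expansion at a point where the gradient is differentiable. -/
lemma taylor_of_gradient_hasFDerivAt
    (h : ∀ x, HasFDerivAt g (innerSL ℝ (ξ x)) x) {T : E →L[ℝ] E} {x : E}
    (hT : HasFDerivAt ξ T x) :
    (∀ y z, ⟪T y, z⟫ = ⟪y, T z⟫) ∧ ∀ ε > 0, ∀ᶠ y in 𝓝 x,
      |g y - g x - ⟪ξ x, y - x⟫ - ⟪T (y - x), y - x⟫ / 2| ≤ ε * ‖y - x‖ ^ 2 := by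
  have hsymm : ∀ y z, ⟪T y, z⟫ = ⟪y, T z⟫ := by
    intro y z
    have h1 : ⟪T y, z⟫ = ⟪T z, y⟫ :=
      second_derivative_symmetric h ((innerSL ℝ (E := E)).hasFDerivAt.comp x hT) y z
    rw [h1, real_inner_comm]
  refine ⟨hsymm, fun ε hε => ?_⟩
  have hT' := hT.isLittleO.def hε
  obtain ⟨δ, hδ, hball⟩ := Metric.eventually_nhds_iff_ball.1 hT'
  filter_upwards [ball_mem_nhds x hδ] with y hy
  set φ : E → ℝ := fun y => g y - ⟪ξ x, y - x⟫ - 1 / 2 * ⟪T (y - x), y - x⟫ with hφ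
  have hφ' : ∀ z, HasFDerivAt φ (innerSL ℝ (ξ z - ξ x - T (z - x))) z := by
    intro z
    have hs : HasFDerivAt (fun y : E => y - x) (ContinuousLinearMap.id ℝ E) z :=
      (hasFDerivAt_id z).sub_const x
    have h2 : HasFDerivAt (fun y : E => ⟪ξ x, y - x⟫) (innerSL ℝ (ξ x)) z :=
      ((innerSL ℝ (ξ x)).hasFDerivAt.comp z hs)
    have h3 := (((T.hasFDerivAt.comp z hs).inner ℝ hs).const_mul (1 / 2))
    refine (((h z).sub h2).sub h3).congr_fderiv ?_
    ext k
    simp [fderivInnerCLM_apply, inner_sub_left]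
    rw [hsymm z k, hsymm x k, real_inner_comm (T k) z, real_inner_comm (T k) x, inner_sub_right]
    ring
  have hseg : ∀ z ∈ closedBall x ‖y - x‖, ‖innerSL ℝ (ξ z - ξ x - T (z - x))‖ ≤
      ε * ‖y - x‖ := by
    intro z hz
    rw [innerSL_apply_norm]
    have hz1 : ‖z - x‖ ≤ ‖y - x‖ := by simpa [dist_eq_norm] using hz
    have hy1 : ‖y - x‖ < δ := by simpa [dist_eq_norm] using hy
    have := hball z (by rw [mem_ball, dist_eq_norm]; linarith)
    exact this.trans (by gcongr)
  have := (convex_closedBall x ‖y - x‖).norm_image_sub_le_of_norm_hasFDerivWithin_le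
    (fun z _ => (hφ' z).hasFDerivWithinAt) hseg (mem_closedBall_self (norm_nonneg _))
    (y := y) (by simp [dist_eq_norm])
  simp only [hφ, sub_self, map_zero, inner_zero_right, mul_zero, sub_zero, Real.norm_eq_abs]
    at this
  rw [show ε * ‖y - x‖ ^ 2 = ε * ‖y - x‖ * ‖y - x‖ by ring]
  convert this using 2
  ring

end Insertion

section Rademacher

variable {E : Type*} [NormedAddCommGroup E] [InnerProductSpace ℝ E] [FiniteDimensional ℝ E]

/-- A Lipschitz map is differentiable at some point of any set which is the image of
an open set under a map with Lipschitz inverse. -/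
lemma exists_differentiableAt_of_antilipschitz {ξ : E → E} {L : NNReal}
    (hξ : LipschitzWith L ξ) {P : Set E} (hP : IsOpen P) (hPne : P.Nonempty) (X : E → E)
    {L' : NNReal} (hX : ∀ p ∈ P, ∀ q ∈ P, ‖p - q‖ ≤ L' * ‖X p - X q‖) :
    ∃ p ∈ P, DifferentiableAt ℝ ξ (X p) := by
  let _ : MeasurableSpace E := borel E
  have _ : BorelSpace E := ⟨rfl⟩
  by_contra! hcon
  have hae := hξ.ae_differentiableAt (μ := MeasureTheory.Measure.hausdorffMeasure
    (Module.finrank ℝ E : ℝ))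
  have hnull : MeasureTheory.Measure.hausdorffMeasure (Module.finrank ℝ E : ℝ) (X '' P) = 0 := by
    refine MeasureTheory.measure_mono_null ?_ hae
    rintro _ ⟨p, hp, rfl⟩
    exact hcon p hp
  have hanti : AntilipschitzWith L' (fun p : P => X p) := by
    refine AntilipschitzWith.of_le_mul_dist fun p q => ?_
    rw [Subtype.dist_eq, dist_eq_norm, dist_eq_norm]
    exact hX p p.2 q q.2
  have h1 := hanti.le_hausdorffMeasure_image (d := (Module.finrank ℝ E : ℝ)) (by positivity) univ
  have h2 : (fun p : P => X p) '' univ = X '' P := by ext; simp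
  rw [h2, hnull, mul_zero] at h1
  have h3 := (isometry_subtype_coe (s := P)).hausdorffMeasure_image
    (d := (Module.finrank ℝ E : ℝ)) (Or.inl (by positivity)) univ
  rw [image_univ, Subtype.range_coe] at h3
  have h4 := hP.measure_pos (MeasureTheory.Measure.hausdorffMeasure
    (Module.finrank ℝ E : ℝ)) hPne
  rw [h3] at h4
  exact absurd h4 (not_lt.2 h1)

end Rademacher

section SecondOrder

variable {E : Type*} [NormedAddCommGroup E] [InnerProductSpace ℝ E]

lemma double_paraboloid {a : ℝ} (ha : 0 < a) (p x y y' : E) :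
    2 * a * ‖x - y‖ ^ 2 + 2 * a * ‖x - y'‖ ^ 2 + ⟪p, x⟫ =
      a * ‖y - y'‖ ^ 2 + ⟪p, y + y'⟫ / 2 - ‖p‖ ^ 2 / (16 * a) +
      4 * a * ‖x - ((1 / 2 : ℝ) • (y + y') - (1 / (8 * a)) • p)‖ ^ 2 := by
  have e1 : x - ((1 / 2 : ℝ) • (y + y') - (1 / (8 * a)) • p) =
    (1 / 2 : ℝ) • ((x - y) + (x - y')) + (1 / (8 * a)) • p := by module
  have e2 : y - y' = (x - y') - (x - y) := by abel
  have e3 : y + y' = (2 : ℝ) • x - ((x - y) + (x - y')) := by module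
  rw [e1, e2, e3]
  generalize x - y = k
  generalize x - y' = m
  simp only [← real_inner_self_eq_norm_sq, inner_add_left, inner_add_right, inner_sub_left,
    inner_sub_right, real_inner_smul_left, real_inner_smul_right, real_inner_comm k p,
    real_inner_comm m p, real_inner_comm k m]
  field_simp
  ring

lemma shifted_paraboloid {a : ℝ} (ha : 0 < a) (p x y : E) :
    a * ‖x - (1 / (4 * a)) • p - y‖ ^ 2 =
      a * ‖x - y‖ ^ 2 - ⟪p, x - y⟫ / 2 + ‖p‖ ^ 2 / (16 * a) := by
  have e1 : x - (1 / (4 * a)) • p - y = (x - y) - (1 / (4 * a)) • p := by abel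
  rw [e1, norm_sub_sq_real, norm_smul, real_inner_smul_right, Real.norm_of_nonneg (by positivity),
    real_inner_comm p (x - y)]
  field_simp
  ring

variable [FiniteDimensional ℝ E]

lemma secondOrder_interior_strict {u w : E → ℝ} (hu : Continuous u) (hw : Continuous w)
    {z e : E} {r κ A B lam C : ℝ} (hr : 0 < r) (hκ : 0 < κ) (hC : 0 ≤ C)
    {G : (E →L[ℝ] E) → E → ℝ} (hG : Ell e lam C G)
    (hmax : ∀ y ∈ closedBall z r, u y + w y ≤ u z + w z - κ * ‖y - z‖ ^ 2)
    (hju : ∀ x ∈ ball z r, ∀ b T, Superjet u x b T → G T b ≤ A)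
    (hjw : ∀ x ∈ ball z r, ∀ b T, Superjet w x b T → B ≤ G (-T) (-b)) : B ≤ A := by
  by_contra! hAB
  obtain ⟨a, ha, ε, hε, Hd⟩ := doubling_interior hu hw hr hκ hr hmax
  have hK := isCompact_closedBall z r
  have hz : z ∈ closedBall z r := mem_closedBall_self hr.le
  obtain ⟨g, ξ, hg1, hg2, hg3⟩ := exists_insertion hu hK ⟨z, hz⟩ ha
  set Θ : E → E → E → ℝ := fun p y y' => u y + w y' - a * ‖y - y'‖ ^ 2 - ⟪p, y + y'⟫ / 2
    with hΘ
  have hmaxp : ∀ p, ∃ q : E × E, q.1 ∈ closedBall z r ∧ q.2 ∈ closedBall z r ∧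
      ∀ y ∈ closedBall z r, ∀ y' ∈ closedBall z r, Θ p y y' ≤ Θ p q.1 q.2 := by
    intro p
    obtain ⟨⟨x, y⟩, ⟨hx, hy⟩, hxy⟩ := (hK.prod hK).exists_isMaxOn ⟨(z, z), hz, hz⟩
      (f := fun q : E × E => Θ p q.1 q.2) (by simp only [hΘ]; fun_prop)
    rw [isMaxOn_iff] at hxy
    simp only [mem_prod, Prod.forall, and_imp] at hxy hx hy
    exact ⟨(x, y), hx, hy, fun y1 h1 y2 h2 => hxy y1 y2 h1 h2⟩
  choose Y hY1 hY2 hYmax using hmaxp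
  set X : E → E := fun p => (1 / 2 : ℝ) • ((Y p).1 + (Y p).2) - (1 / (8 * a)) • p with hX
  set m : E → ℝ := fun p => Θ p (Y p).1 (Y p).2 + ‖p‖ ^ 2 / (16 * a) with hm
  have hanti : ∀ p q, ‖p - q‖ ≤ 16 * a * ‖X p - X q‖ := by
    intro p q
    have key : ∀ p q : E, ∀ d : E, m q - 4 * a * ‖d‖ ^ 2 + ⟪q - p, X q + d⟫ ≤ m p := by
      intro p q d
      have h1 := double_paraboloid ha q (X q + d) (Y q).1 (Y q).2
      have h2 := double_paraboloid ha p (X q + d) (Y q).1 (Y q).2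
      have h3 := hYmax p _ (hY1 q) _ (hY2 q)
      have e1 : X q + d - ((1 / 2 : ℝ) • ((Y q).1 + (Y q).2) - (1 / (8 * a)) • q) = d := by
        simp only [hX]; abel
      rw [e1] at h1
      have h4 : 0 ≤ 4 * a *
        ‖X q + d - ((1 / 2 : ℝ) • ((Y q).1 + (Y q).2) - (1 / (8 * a)) • p)‖ ^ 2 := by positivity
      simp only [hm, hΘ] at h3 ⊢
      rw [inner_sub_left]
      linarith
    have h1 := key p q ((1 / (8 * a)) • (q - p))
    have h2 := key q p 0
    rw [norm_smul, inner_add_right, real_inner_smul_right, real_inner_self_eq_norm_sq,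
      Real.norm_of_nonneg (by positivity)] at h1
    rw [add_zero, norm_zero] at h2
    have h3 : ⟪p - q, X p⟫ = -⟪q - p, X p⟫ := by rw [← inner_neg_left, neg_sub]
    have h4 := (abs_le.1 (abs_real_inner_le_norm (q - p) (X p - X q))).2
    rw [inner_sub_right] at h4
    have h5 : 4 * a * (1 / (8 * a) * ‖q - p‖) ^ 2 = 1 / (16 * a) * ‖q - p‖ ^ 2 := by
      field_simp; ring
    have h6 : 1 / (8 * a) * ‖q - p‖ ^ 2 = 2 * (1 / (16 * a) * ‖q - p‖ ^ 2) := by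
      field_simp; ring
    have h7 : 1 / (16 * a) * ‖q - p‖ ^ 2 ≤ ‖q - p‖ * ‖X p - X q‖ := by
      rw [h5] at h1; linarith
    rw [div_mul_eq_mul_div, div_le_iff₀ (by positivity)] at h7
    rw [norm_sub_rev p q]
    rcases (norm_nonneg (q - p)).eq_or_lt with h0 | h0
    · rw [← h0]; positivity
    · refine le_of_mul_le_mul_left ?_ h0
      nlinarith
  set ε' := min ε ((B - A) / (2 * (C + 1))) with hε'
  have hε'pos : 0 < ε' := lt_min hε (div_pos (by linarith) (by linarith))
  obtain ⟨p, hp, hdiff⟩ := exists_differentiableAt_of_antilipschitz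
    (lipschitz_of_quadratic_expansion ha hg1) (isOpen_ball (x := (0 : E)) (ε := ε'))
    ⟨0, mem_ball_self hε'pos⟩ X (L' := Real.toNNReal (16 * a)) (by
      intro p _ q _
      rw [Real.coe_toNNReal _ (by positivity)]
      exact hanti p q)
  rw [mem_ball_zero_iff] at hp
  obtain ⟨hsymm, htay⟩ := taylor_of_gradient_hasFDerivAt
    (hasFDerivAt_of_quadratic_expansion hg1) hdiff.hasFDerivAt
  set T := fderiv ℝ ξ (X p)
  have hle := hYmax p z hz z hz
  obtain ⟨hyi, hyi'⟩ := Hd p (hp.trans_le (min_le_left _ _)) _ (hY1 p) _ (hY2 p) (by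
    have e1 : ⟪p, z + z⟫ / 2 = ⟪p, z⟫ := by rw [inner_add_right]; ring
    simp only [hΘ, sub_self, norm_zero, e1] at hle
    linarith)
  set y := (Y p).1
  set y' := (Y p).2
  have hub : ∀ x, ∀ y2 ∈ closedBall z r, g x ≤ m p + ⟪p, x⟫ - w y2 + 2 * a * ‖x - y2‖ ^ 2 := by
    intro x y2 hy2
    have h1 := hg3 x (y2 - (1 / (4 * a)) • p)
      (Θ p y y' - w y2 + ⟪p, y2⟫ - ‖p‖ ^ 2 / (16 * a)) (by
        intro y1 hy1
        rw [shifted_paraboloid ha]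
        have := hYmax p y1 hy1 y2 hy2
        simp only [hΘ] at this ⊢
        rw [norm_sub_rev y1 y2] at this
        rw [inner_sub_right]
        rw [inner_add_right] at this
        linarith)
    have h2 := shifted_paraboloid ha (-p) x y2
    have e1 : x - (y2 - (1 / (4 * a)) • p) = x - (1 / (4 * a)) • -p - y2 := by
      rw [smul_neg]; abel
    rw [e1] at h1
    rw [inner_neg_left, norm_neg, inner_sub_right] at h2
    have h3 : ‖p‖ ^ 2 / (16 * a) * 2 = ‖p‖ ^ 2 / (16 * a) + ‖p‖ ^ 2 / (16 * a) := by ring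
    simp only [hm]
    linarith
  have hdp := double_paraboloid ha p (X p) y y'
  have hXp : X p - ((1 / 2 : ℝ) • (y + y') - (1 / (8 * a)) • p) = 0 := by
    simp only [hX]; abel
  rw [hXp, norm_zero] at hdp
  have hlow := hg2 (X p) y (hY1 p)
  have hupp := hub (X p) y' (hY2 p)
  have hmval : m p = u y + w y' - 2 * a * ‖X p - y‖ ^ 2 - 2 * a * ‖X p - y'‖ ^ 2 - ⟪p, X p⟫ := by
    simp only [hm, hΘ]; linarith
  set η := (B - A) / (8 * (C + 1)) with hη
  have hηpos : 0 < η := div_pos (by linarith) (by linarith)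
  have htend : ∀ y : E, Tendsto (fun y2 => X p + (y2 - y)) (𝓝 y) (𝓝 (X p)) := by
    intro y
    have : Continuous fun y2 : E => X p + (y2 - y) := by fun_prop
    simpa using this.tendsto y
  have j1 : Superjet u y (ξ (X p)) (T + quadOp e (2 * η) 0) := by
    refine ⟨fun y z => ?_, ?_⟩
    · simp only [add_apply, inner_add_left, inner_add_right, hsymm y z, quadOp_symm]
    · filter_upwards [(htend y).eventually (htay η hηpos), isOpen_ball.mem_nhds
        (show y ∈ ball z r by simpa [dist_eq_norm] using hyi)] with y2 h1 hy2
      have h2 := hg2 (X p + (y2 - y)) y2 (ball_subset_closedBall hy2)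
      have e1 : X p + (y2 - y) - y2 = X p - y := by abel
      rw [add_sub_cancel_left, abs_le] at h1
      rw [e1] at h2
      simp only [add_apply, inner_add_left, quadOp_inner]
      linarith [h1.2]
  have j2 : Superjet w y' (p - ξ (X p)) (-T + quadOp e (2 * η) 0) := by
    refine ⟨fun y z => ?_, ?_⟩
    · simp only [add_apply, neg_apply, inner_neg_left, inner_neg_right, inner_add_left,
        inner_add_right, hsymm y z, quadOp_symm]
    · filter_upwards [(htend y').eventually (htay η hηpos), isOpen_ball.mem_nhds
        (show y' ∈ ball z r by simpa [dist_eq_norm] using hyi')] with y2 h1 hy2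
      have h2 := hub (X p + (y2 - y')) y2 (ball_subset_closedBall hy2)
      have e1 : X p + (y2 - y') - y2 = X p - y' := by abel
      rw [add_sub_cancel_left, abs_le] at h1
      rw [e1, inner_add_right] at h2
      simp only [add_apply, neg_apply, inner_neg_left, inner_add_left, inner_sub_left,
        quadOp_inner]
      linarith [h1.1]
  have k1 := hju y (by simpa [dist_eq_norm] using hyi) _ _ j1
  have k2 := hjw y' (by simpa [dist_eq_norm] using hyi') _ _ j2
  have k3 := hG (-(-T + quadOp e (2 * η) 0)) (-(p - ξ (X p))) p (4 * η) 0 (by positivity) le_rfl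
  have e1 : -(-T + quadOp e (2 * η) 0) + quadOp e (4 * η) 0 = T + quadOp e (2 * η) 0 := by
    ext k
    simp only [add_apply, neg_apply, quadOp_apply]
    module
  have e2 : -(p - ξ (X p)) + p = ξ (X p) := by abel
  rw [e1, e2] at k3
  have k4 : C * (4 * η + ‖p‖) ≤ C * ((B - A) / (C + 1)) := by
    refine mul_le_mul_of_nonneg_left ?_ hC
    have h1 : ‖p‖ ≤ (B - A) / (2 * (C + 1)) := hp.le.trans (min_le_right _ _)
    have h2 : 4 * η = (B - A) / (2 * (C + 1)) := by rw [hη]; field_simp; ring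
    have h3 : (B - A) / (C + 1) = (B - A) / (2 * (C + 1)) + (B - A) / (2 * (C + 1)) := by
      field_simp; ring
    linarith
  have k5 : C * ((B - A) / (C + 1)) < B - A := by
    rw [mul_div_assoc', div_lt_iff₀ (by linarith)]
    nlinarith
  linarith

/-- Comparison for uniformly elliptic second order operators at an interior maximum. -/
lemma secondOrder_interior {u w : E → ℝ} (hu : Continuous u) (hw : Continuous w)
    {z e : E} {r A B lam C : ℝ} (hr : 0 < r) (hC : 0 ≤ C)
    {G : (E →L[ℝ] E) → E → ℝ} (hG : Ell e lam C G)
    (hmax : ∀ y ∈ closedBall z r, u y + w y ≤ u z + w z)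
    (hju : ∀ x ∈ ball z r, ∀ b T, Superjet u x b T → G T b ≤ A)
    (hjw : ∀ x ∈ ball z r, ∀ b T, Superjet w x b T → B ≤ G (-T) (-b)) : B ≤ A := by
  have key : ∀ κ > 0, B ≤ A + C * (2 * κ + 2 * κ * r) := by
    intro κ hκ
    refine secondOrder_interior_strict (u := fun y => u y - κ * ‖y - z‖ ^ 2) (w := w)
      (by fun_prop) hw hr hκ hC hG ?_ ?_ hjw
    · intro y hy
      have := hmax y hy
      simp only [sub_self, norm_zero]
      linarith
    · intro x hx b T hj
      have h1 := hju x hx _ _ (Superjet.add_quad (u := u) e 0 z (2 * κ) 0 (b := b) (T := T) (by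
        convert hj using 1
        funext x'; simp only [inner_zero_left]; ring))
      have h2 := hG T b ((2 * κ) • (x - z)) (2 * κ) 0 (by positivity) le_rfl
      simp only [zero_mul, zero_smul, zero_add, sub_zero] at h1
      have h3 : ‖(2 * κ) • (x - z)‖ ≤ 2 * κ * r := by
        rw [norm_smul, Real.norm_of_nonneg (by positivity)]
        have : ‖x - z‖ < r := by simpa [dist_eq_norm] using hx
        gcongr
      have h4 := mul_le_mul_of_nonneg_left h3 hC
      linarith
  have hlim : Tendsto (fun κ : ℝ => A + C * (2 * κ + 2 * κ * r)) (𝓝[>] 0)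
      (𝓝 (A + C * (2 * 0 + 2 * 0 * r))) :=
    (Continuous.tendsto (by fun_prop) 0).mono_left nhdsWithin_le_nhds
  have := ge_of_tendsto hlim (by
    filter_upwards [self_mem_nhdsWithin] with κ hκ using key κ hκ)
  simpa using this

end SecondOrder

section HalfSpace

variable {E : Type*} [NormedAddCommGroup E] [InnerProductSpace ℝ E]

/-- Squared norm of the component of `x` orthogonal to the unit vector `e`. -/
def tang (e x : E) : ℝ := ‖x‖ ^ 2 - ⟪e, x⟫ ^ 2

/-- Slopes `s` such that `s ⟪e, x⟫` bounds `f` from above near the origin in the half space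
`0 ≤ ⟪e, x⟫`, up to a quadratic tangential error. -/
def Adm (f : E → ℝ) (e : E) : Set ℝ :=
  {s | ∃ ρ > 0, ∃ C : ℝ, ∀ x ∈ ball (0 : E) ρ, 0 ≤ ⟪e, x⟫ → f x ≤ s * ⟪e, x⟫ + C * tang e x}

/-- Barrier function on the half cylinder `tang e x ≤ ρ²`, `0 ≤ ⟪e, x⟫ ≤ τ`. -/
def barrierFun (e : E) (s N μ τ : ℝ) (x : E) : ℝ :=
  s * ⟪e, x⟫ + N * (τ * ⟪e, x⟫ - ⟪e, x⟫ ^ 2) + μ * tang e x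

/-- Comparison of `U` with the barrier on a half cylinder. -/
def CylComparison (U : E → ℝ) (e : E) (s N μ ρ τ : ℝ) : Prop :=
  (∀ x, tang e x ≤ ρ ^ 2 → 0 ≤ ⟪e, x⟫ → ⟪e, x⟫ ≤ τ →
      (⟪e, x⟫ = 0 ∨ ⟪e, x⟫ = τ ∨ tang e x = ρ ^ 2) → U x ≤ barrierFun e s N μ τ x) →
    ∀ x, tang e x ≤ ρ ^ 2 → 0 ≤ ⟪e, x⟫ → ⟪e, x⟫ ≤ τ → U x ≤ barrierFun e s N μ τ x

/-- `U` can be compared with barriers of slope `s` on all small half cylinders. -/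
def Barrier (U : E → ℝ) (e : E) (s : ℝ) : Prop :=
  ∀ μ ≥ 0, ∃ N ≥ 0, ∃ ρ₀ > 0, ∀ ρ ∈ Ioo 0 ρ₀, ∀ τ ∈ Ioo 0 ρ₀, CylComparison U e s N μ ρ τ

variable {e : E}

lemma tang_nonneg (he : ‖e‖ = 1) (x : E) : 0 ≤ tang e x := by
  have h := abs_real_inner_le_norm e x
  rw [he, one_mul] at h
  have := sq_le_sq' (by linarith [neg_abs_le ⟪e, x⟫, norm_nonneg x, abs_nonneg ⟪e, x⟫])
    ((le_abs_self _).trans h)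
  unfold tang; linarith

lemma tang_neg_left (e x : E) : tang (-e) x = tang e x := by
  simp [tang]

lemma tang_le_sq_norm (e x : E) : tang e x ≤ ‖x‖ ^ 2 := by
  unfold tang; nlinarith [sq_nonneg ⟪e, x⟫]

lemma sq_norm_eq_tang (e x : E) : ‖x‖ ^ 2 = tang e x + ⟪e, x⟫ ^ 2 := by
  unfold tang; ring

lemma abs_inner_unit_le (he : ‖e‖ = 1) (x : E) : |⟪e, x⟫| ≤ ‖x‖ := by
  simpa [he] using abs_real_inner_le_norm e x

lemma inner_self_unit (he : ‖e‖ = 1) : ⟪e, e⟫ = 1 := by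
  rw [real_inner_self_eq_norm_sq, he]; norm_num

lemma sq_norm_sub_inner_smul (he : ‖e‖ = 1) (x : E) : ‖x - ⟪e, x⟫ • e‖ ^ 2 = tang e x := by
  rw [norm_sub_sq_real, norm_smul, real_inner_smul_right, he, real_inner_comm e x]
  simp only [tang, mul_one, Real.norm_eq_abs, sq_abs]
  ring

lemma continuous_tang (e : E) : Continuous (tang e) := by
  unfold tang; fun_prop

lemma tang_smul_self (he : ‖e‖ = 1) (t : ℝ) : tang e (t • e) = 0 := by
  simp [tang, real_inner_smul_right, norm_smul, he]

lemma norm_le_of_mem_cylinder {ρ τ : ℝ} {x : E} (hρ : 0 ≤ ρ) (hτ : 0 ≤ τ)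
    (h1 : tang e x ≤ ρ ^ 2) (h2 : 0 ≤ ⟪e, x⟫) (h3 : ⟪e, x⟫ ≤ τ) : ‖x‖ ≤ ρ + τ := by
  refine le_of_sq_le_sq ?_ (by positivity)
  rw [sq_norm_eq_tang e]
  nlinarith [mul_nonneg hρ hτ]

lemma Adm.exists_const (he : ‖e‖ = 1) {f : E → ℝ} {s : ℝ} (h : s ∈ Adm f e) {s' : ℝ}
    (hs : s ≤ s') (C₀ : ℝ) : ∃ ρ > 0, ∃ C ≥ C₀, ∀ x ∈ ball (0 : E) ρ, 0 ≤ ⟪e, x⟫ →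
      f x ≤ s' * ⟪e, x⟫ + C * tang e x := by
  obtain ⟨ρ, hρ, C, hC⟩ := h
  refine ⟨ρ, hρ, max C C₀, le_max_right _ _, fun x hx ht => (hC x hx ht).trans ?_⟩
  have := tang_nonneg he x
  gcongr
  exact le_max_left _ _

lemma Adm.mono (he : ‖e‖ = 1) {f : E → ℝ} {s s' : ℝ} (h : s ∈ Adm f e) (hs : s ≤ s') :
    s' ∈ Adm f e := by
  obtain ⟨ρ, hρ, C, -, hC⟩ := Adm.exists_const he h hs 0
  exact ⟨ρ, hρ, C, hC⟩

lemma mem_Adm_of_sInf_lt (he : ‖e‖ = 1) {f : E → ℝ} (hne : (Adm f e).Nonempty) {s : ℝ}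
    (hs : sInf (Adm f e) < s) : s ∈ Adm f e := by
  obtain ⟨s', hs', hlt⟩ := exists_lt_of_csInf_lt hne hs
  exact Adm.mono he hs' hlt.le

/-- The extremal slope of `f` along `e` is a limit of gradients of superjets. -/
lemma sInf_Adm_smul_mem [FiniteDimensional ℝ E] (he : ‖e‖ = 1) {f : E → ℝ} (hf : Continuous f)
    {r C : ℝ} (hr : 0 < r) {S : Set E} (hS : IsClosed S)
    (hΓ : ∀ x ∈ ball (0 : E) r, ⟪e, x⟫ = 0 → f x ≤ C * tang e x)
    (hj : ∀ x ∈ ball (0 : E) r, 0 < ⟪e, x⟫ → ∀ b T, Superjet f x b T → b ∈ S)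
    (hne : (Adm f e).Nonempty) (hbdd : BddBelow (Adm f e)) : sInf (Adm f e) • e ∈ S := by
  rw [← hS.closure_eq, Metric.mem_closure_iff]
  intro ε' hε'
  set m := sInf (Adm f e)
  obtain ⟨ε, hε, hε6⟩ : ∃ ε > 0, 7 * ε < ε' := ⟨ε' / 8, by positivity, by linarith⟩
  obtain ⟨s', hs', hs'm⟩ := exists_lt_of_csInf_lt hne (lt_add_of_pos_right m hε)
  obtain ⟨ρ₀, hρ₀, C₀, hC₀, hbound⟩ := Adm.exists_const he hs' hs'm.le (max C 0)
  have hCC₀ : C ≤ C₀ := (le_max_left _ _).trans hC₀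
  have h0C₀ : 0 ≤ C₀ := (le_max_right _ _).trans hC₀
  obtain ⟨ρ, hρ, hρ1, hρ2, hρ3⟩ : ∃ ρ > 0, ρ < ρ₀ ∧ ρ < r ∧ 2 * C₀ * ρ ≤ ε := by
    refine ⟨min (min (ρ₀ / 2) (r / 2)) (ε / (2 * (C₀ + 1))), by positivity, ?_, ?_, ?_⟩
    · exact ((min_le_left _ _).trans (min_le_left _ _)).trans_lt (by linarith)
    · exact ((min_le_left _ _).trans (min_le_right _ _)).trans_lt (by linarith)
    · have := min_le_right (min (ρ₀ / 2) (r / 2)) (ε / (2 * (C₀ + 1)))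
      rw [le_div_iff₀ (by positivity)] at this
      have hpos : 0 < min (min (ρ₀ / 2) (r / 2)) (ε / (2 * (C₀ + 1))) := by positivity
      nlinarith
  set N := 2 * ε / ρ with hN
  have hNpos : 0 < N := by positivity
  have hs1 : m - ε / 2 ∉ Adm f e := notMem_of_lt_csInf (by linarith : m - ε / 2 < m) hbdd
  set φ : E → ℝ := fun y => f y - (⟪(m - ε) • e, y⟫ + 2 * (C₀ + N) / 2 * ‖y - 0‖ ^ 2 -
    2 * C₀ / 2 * ⟪e, y - 0⟫ ^ 2) with hφ
  have hφeq : ∀ y, φ y = f y - ((m - ε) * ⟪e, y⟫ + C₀ * tang e y + N * ‖y‖ ^ 2) := by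
    intro y
    simp only [hφ, tang, sub_zero, real_inner_smul_left]
    ring
  have hHB : IsCompact (closedBall (0 : E) ρ ∩ {x | 0 ≤ ⟪e, x⟫}) :=
    (isCompact_closedBall 0 ρ).inter_right (isClosed_le continuous_const (by fun_prop))
  have h0 : (0 : E) ∈ closedBall (0 : E) ρ ∩ {x | 0 ≤ ⟪e, x⟫} := by
    simp [hρ.le]
  obtain ⟨x, ⟨hx, hxt⟩, hmax⟩ := hHB.exists_isMaxOn ⟨0, h0⟩ (f := φ) (by
    simp only [hφ]; fun_prop)
  rw [isMaxOn_iff] at hmax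
  have hpos : 0 < φ x := by
    by_contra! hcon
    apply hs1
    refine ⟨min ρ (ε / (2 * N)), by positivity, C₀ + N, fun y hy hty => ?_⟩
    rw [mem_ball_zero_iff, lt_min_iff] at hy
    have h1 := (hmax y ⟨by simpa using hy.1.le, hty⟩).trans hcon
    rw [hφeq, sq_norm_eq_tang e y] at h1
    have h2 : ⟪e, y⟫ < ε / (2 * N) :=
      ((le_abs_self _).trans (abs_inner_unit_le he y)).trans_lt hy.2
    rw [lt_div_iff₀ (by positivity)] at h2
    nlinarith
  simp only [mem_ofPred_eq, mem_closedBall_zero_iff] at hx hxt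
  have hxt' : 0 < ⟪e, x⟫ := by
    rcases hxt.eq_or_lt with h | h
    · have h1 := hΓ x (by simpa using hx.trans_lt hρ2) h.symm
      rw [hφeq, ← h] at hpos
      nlinarith [mul_le_mul_of_nonneg_right hCC₀ (tang_nonneg he x), sq_nonneg ‖x‖,
        mul_nonneg hNpos.le (sq_nonneg ‖x‖)]
    · exact h
  have hx' : ‖x‖ < ρ := by
    rcases hx.eq_or_lt with h | h
    · have h1 := hbound x (by simpa using hx.trans_lt hρ1) hxt
      rw [hφeq, h] at hpos
      have h2 : N * ρ ^ 2 = 2 * ε * ρ := by rw [hN]; field_simp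
      have h3 : ⟪e, x⟫ ≤ ρ := h ▸ (le_abs_self _).trans (abs_inner_unit_le he x)
      nlinarith
    · exact h
  have hjet := Superjet.of_quad (u := f) (x := x) e ((m - ε) • e) 0 (2 * (C₀ + N)) (2 * C₀) (by
    filter_upwards [isOpen_ball.mem_nhds (show x ∈ ball (0 : E) ρ by simpa using hx'),
      (isOpen_lt continuous_const (by fun_prop : Continuous fun y : E => ⟪e, y⟫)).mem_nhds hxt']
      with y hy hty
    exact hmax y ⟨ball_subset_closedBall hy, le_of_lt hty⟩)
  refine ⟨_, hj x (by simpa using hx'.trans hρ2) hxt' _ _ hjet, ?_⟩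
  rw [dist_eq_norm]
  have e1 : m • e - ((m - ε) • e + (2 * (C₀ + N)) • (x - 0) - (2 * C₀ * ⟪e, x - 0⟫) • e) =
      ε • e - (2 * C₀) • (x - ⟪e, x⟫ • e) - (2 * N) • x := by
    simp only [sub_zero]; module
  rw [e1]
  have h1 : ‖x - ⟪e, x⟫ • e‖ ≤ ‖x‖ := by
    refine le_of_sq_le_sq ?_ (norm_nonneg _)
    rw [sq_norm_sub_inner_smul he]
    exact tang_le_sq_norm e x
  have h2 : 2 * N * ρ = 4 * ε := by rw [hN]; field_simp; ring
  calc _ ≤ ‖ε • e‖ + ‖(2 * C₀) • (x - ⟪e, x⟫ • e)‖ + ‖(2 * N) • x‖ :=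
        (norm_sub_le _ _).trans (add_le_add_left (norm_sub_le _ _) _)
    _ = ε + 2 * C₀ * ‖x - ⟪e, x⟫ • e‖ + 2 * N * ‖x‖ := by
        rw [norm_smul, norm_smul, norm_smul, he, Real.norm_of_nonneg hε.le,
          Real.norm_of_nonneg (by positivity), Real.norm_of_nonneg (by positivity), mul_one]
    _ ≤ ε + 2 * C₀ * ρ + 2 * N * ρ := by
        gcongr
        exact h1.trans hx'.le
    _ < ε' := by linarith

/-- If the comparison with a barrier fails, the barrier touches from above at an interior
point of the half cylinder. -/
lemma exists_superjet_of_not_cylComparison [FiniteDimensional ℝ E] {U : E → ℝ}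
    (hU : Continuous U) {s N μ ρ τ : ℝ} (hρ : 0 ≤ ρ) (hτ : 0 ≤ τ)
    (h : ¬ CylComparison U e s N μ ρ τ) :
    ∃ x, tang e x < ρ ^ 2 ∧ 0 < ⟪e, x⟫ ∧ ⟪e, x⟫ < τ ∧
      Superjet U x ((s + N * (τ - 2 * ⟪e, x⟫)) • e + (2 * μ) • (x - ⟪e, x⟫ • e))
        (quadOp e (2 * μ) (2 * (N + μ))) := by
  unfold CylComparison at h
  push Not at h
  obtain ⟨hb, x₀, h1, h2, h3, hlt⟩ := h
  set φ : E → ℝ := fun y => U y - (⟪(s + N * τ) • e, y⟫ + 2 * μ / 2 * ‖y - 0‖ ^ 2 -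
    2 * (N + μ) / 2 * ⟪e, y - 0⟫ ^ 2) with hφ
  have hφeq : ∀ y, φ y = U y - barrierFun e s N μ τ y := by
    intro y
    simp only [hφ, barrierFun, tang, sub_zero, real_inner_smul_left]
    ring
  have htc := continuous_tang e
  have hic : Continuous fun y : E => ⟪e, y⟫ := by fun_prop
  have hQ : IsCompact {x | tang e x ≤ ρ ^ 2 ∧ 0 ≤ ⟪e, x⟫ ∧ ⟪e, x⟫ ≤ τ} := by
    refine (isCompact_closedBall (0 : E) (ρ + τ)).of_isClosed_subset ?_ ?_
    · exact (isClosed_le htc continuous_const).inter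
        ((isClosed_le continuous_const hic).inter (isClosed_le hic continuous_const))
    · rintro x ⟨h1, h2, h3⟩
      simpa using norm_le_of_mem_cylinder hρ hτ h1 h2 h3
  obtain ⟨x, ⟨hx1, hx2, hx3⟩, hmax⟩ := hQ.exists_isMaxOn ⟨x₀, h1, h2, h3⟩ (f := φ) (by
    simp only [hφ]; fun_prop)
  rw [isMaxOn_iff] at hmax
  have hpos : 0 < φ x := by
    refine lt_of_lt_of_le ?_ (hmax x₀ ⟨h1, h2, h3⟩)
    rw [hφeq]; linarith
  rw [hφeq] at hpos
  have hn : ¬ (⟪e, x⟫ = 0 ∨ ⟪e, x⟫ = τ ∨ tang e x = ρ ^ 2) := fun hc => by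
    have := hb x hx1 hx2 hx3 hc
    linarith
  push Not at hn
  have hx1' := lt_of_le_of_ne hx1 hn.2.2
  have hx2' := lt_of_le_of_ne hx2 hn.1.symm
  have hx3' := lt_of_le_of_ne hx3 hn.2.1
  refine ⟨x, hx1', hx2', hx3', ?_⟩
  have := Superjet.of_quad (u := U) (x := x) e ((s + N * τ) • e) 0 (2 * μ) (2 * (N + μ)) (by
    filter_upwards [(isOpen_lt htc continuous_const).mem_nhds hx1',
      (isOpen_lt continuous_const hic).mem_nhds hx2',
      (isOpen_lt hic continuous_const).mem_nhds hx3'] with y hy1 hy2 hy3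
    exact hmax y ⟨le_of_lt hy1, le_of_lt hy2, le_of_lt hy3⟩)
  convert this using 1
  simp only [sub_zero]
  module

end HalfSpace

section Barriers

variable {E : Type*} [NormedAddCommGroup E] [InnerProductSpace ℝ E] {e : E}

lemma barrier_secondOrder [FiniteDimensional ℝ E] (he : ‖e‖ = 1) {U : E → ℝ}
    (hU : Continuous U) {r A lam C : ℝ} (hr : 0 < r) (hlam : 0 < lam) (hC : 0 ≤ C)
    {G : (E →L[ℝ] E) → E → ℝ} (hG : Ell e lam C G)
    (hj : ∀ x ∈ ball (0 : E) r, 0 < ⟪e, x⟫ → ∀ b T, Superjet U x b T → G T b ≤ A) :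
    ∃ ρ₀ > 0, ∀ s, ∀ μ ≥ 0, ∃ N ≥ 0, ∀ ρ ∈ Ioo 0 ρ₀, ∀ τ ∈ Ioo 0 ρ₀,
      CylComparison U e s N μ ρ τ := by
  refine ⟨min (r / 2) (min 1 (lam / (C + 1))), by positivity, fun s μ hμ => ?_⟩
  set N := (|A| + |G 0 0| + C * (4 * μ + |s|) + 1) / lam with hN
  have hNpos : 0 ≤ N := by positivity
  have hNlam : N * lam = |A| + |G 0 0| + C * (4 * μ + |s|) + 1 := by rw [hN]; field_simp
  refine ⟨N, hNpos, ?_⟩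
  rintro ρ ⟨hρ, hρ'⟩ τ ⟨hτ, hτ'⟩
  rw [lt_min_iff, lt_min_iff] at hρ' hτ'
  have hτ3 := (lt_div_iff₀ (by positivity)).1 hτ'.2.2
  by_contra hcon
  obtain ⟨x, h1, h2, h3, hx⟩ := exists_superjet_of_not_cylComparison hU hρ.le hτ.le hcon
  have hxr : x ∈ ball (0 : E) r := by
    have := norm_le_of_mem_cylinder hρ.le hτ.le h1.le h2.le h3.le
    rw [mem_ball_zero_iff]; linarith
  have k1 := hj x hxr h2 _ _ hx
  set q := (s + N * (τ - 2 * ⟪e, x⟫)) • e + (2 * μ) • (x - ⟪e, x⟫ • e)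
  have k2 := hG 0 0 q (2 * μ) (2 * (N + μ)) (by positivity) (by positivity)
  rw [zero_add, zero_add] at k2
  have hq1 : ‖x - ⟪e, x⟫ • e‖ ≤ ρ := by
    refine le_of_sq_le_sq ?_ hρ.le
    rw [sq_norm_sub_inner_smul he]
    exact h1.le
  have hq2 : |s + N * (τ - 2 * ⟪e, x⟫)| ≤ |s| + N * τ := by
    refine (abs_add_le _ _).trans ?_
    rw [abs_mul, abs_of_nonneg hNpos]
    gcongr
    rw [abs_le]; constructor <;> linarith
  have hq : ‖q‖ ≤ |s| + N * τ + 2 * μ := by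
    refine (norm_add_le _ _).trans ?_
    rw [norm_smul, norm_smul, he, mul_one, Real.norm_eq_abs, Real.norm_of_nonneg (by positivity)]
    nlinarith
  have k3 := mul_le_mul_of_nonneg_left hq hC
  have k4 : C * τ ≤ lam := by nlinarith
  have k5 := mul_le_mul_of_nonneg_left k4 hNpos
  have k6 := neg_abs_le (G 0 0)
  have k7 := le_abs_self A
  have k8 : 0 ≤ lam * μ := by positivity
  nlinarith

lemma barrier_firstOrder [FiniteDimensional ℝ E] (he : ‖e‖ = 1) {U : E → ℝ}
    (hU : Continuous U) {r : ℝ} (hr : 0 < r) {S : Set E} (hS : IsClosed S)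
    (hj : ∀ x ∈ ball (0 : E) r, 0 < ⟪e, x⟫ → ∀ b T, Superjet U x b T → b ∈ S) {s : ℝ}
    (hs : s • e ∉ S) : Barrier U e s := by
  intro μ hμ
  obtain ⟨δ, hδ, hball⟩ := Metric.mem_nhds_iff.1 (hS.isOpen_compl.mem_nhds hs)
  refine ⟨0, le_rfl, min (r / 2) (δ / (2 * (μ + 1))), by positivity, ?_⟩
  rintro ρ ⟨hρ, hρ'⟩ τ ⟨hτ, hτ'⟩
  rw [lt_min_iff] at hρ' hτ'
  have hρ2 := (lt_div_iff₀ (by positivity)).1 hρ'.2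
  by_contra hcon
  obtain ⟨x, h1, h2, h3, hx⟩ := exists_superjet_of_not_cylComparison hU hρ.le hτ.le hcon
  have hxr : x ∈ ball (0 : E) r := by
    have := norm_le_of_mem_cylinder hρ.le hτ.le h1.le h2.le h3.le
    rw [mem_ball_zero_iff]; linarith
  refine hball ?_ (hj x hxr h2 _ _ hx)
  have hq1 : ‖x - ⟪e, x⟫ • e‖ ≤ ρ := by
    refine le_of_sq_le_sq ?_ hρ.le
    rw [sq_norm_sub_inner_smul he]
    exact h1.le
  rw [mem_ball, dist_eq_norm, zero_mul, add_zero, add_sub_cancel_left, norm_smul,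
    Real.norm_of_nonneg (by positivity)]
  nlinarith

lemma Adm_nonempty_secondOrder [FiniteDimensional ℝ E] (he : ‖e‖ = 1) {U : E → ℝ}
    (hU : Continuous U) {r A lam C c : ℝ} (hr : 0 < r) (hlam : 0 < lam) (hC : 0 ≤ C)
    {G : (E →L[ℝ] E) → E → ℝ} (hG : Ell e lam C G)
    (hj : ∀ x ∈ ball (0 : E) r, 0 < ⟪e, x⟫ → ∀ b T, Superjet U x b T → G T b ≤ A)
    (hΓ : ∀ x ∈ ball (0 : E) r, ⟪e, x⟫ = 0 → U x ≤ c * tang e x) : (Adm U e).Nonempty := by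
  obtain ⟨ρ₀, hρ₀, H⟩ := barrier_secondOrder he hU hr hlam hC hG hj
  obtain ⟨ρ, hρ, hρ1, hρ2⟩ : ∃ ρ > 0, ρ < ρ₀ ∧ 2 * ρ < r :=
    ⟨min ρ₀ r / 3, by positivity, by linarith [min_le_left ρ₀ r], by linarith [min_le_right ρ₀ r]⟩
  obtain ⟨B, hB⟩ := (isCompact_closedBall (0 : E) r).exists_bound_of_continuousOn hU.continuousOn
  have hB0 : 0 ≤ B := (norm_nonneg _).trans (hB 0 (by simp [hr.le]))
  set μ := max 0 (max c (B / ρ ^ 2)) with hμ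
  have hμ0 : 0 ≤ μ := le_max_left _ _
  have hμc : c ≤ μ := (le_max_left _ _).trans (le_max_right _ _)
  have hμB : B ≤ μ * ρ ^ 2 := by
    rw [← div_le_iff₀ (by positivity)]
    exact (le_max_right _ _).trans (le_max_right _ _)
  obtain ⟨N, hN, HN⟩ := H (B / ρ) μ hμ0
  have hcomp := HN ρ ⟨hρ, hρ1⟩ ρ ⟨hρ, hρ1⟩ (by
    intro x h1 h2 h3 hb
    have hxn := norm_le_of_mem_cylinder hρ.le hρ.le h1 h2 h3
    have hUB : U x ≤ B := (le_abs_self _).trans (hB x (by simp; linarith))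
    have htn := tang_nonneg he x
    have p1 : 0 ≤ B / ρ * ⟪e, x⟫ := by positivity
    have p2 : 0 ≤ N * (ρ * ⟪e, x⟫ - ⟪e, x⟫ ^ 2) := mul_nonneg hN (by nlinarith)
    have p3 : 0 ≤ μ * tang e x := by positivity
    unfold barrierFun
    rcases hb with hb | hb | hb
    · have := hΓ x (by simp; linarith) hb
      have := mul_le_mul_of_nonneg_right hμc htn
      linarith
    · have : B / ρ * ⟪e, x⟫ = B := by rw [hb]; field_simp
      linarith
    · rw [hb]; linarith)
  refine ⟨B / ρ + N * ρ, ρ, hρ, μ, fun x hx ht => ?_⟩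
  rw [mem_ball_zero_iff] at hx
  have h1 : ‖x‖ ^ 2 ≤ ρ ^ 2 := by gcongr
  have := hcomp x ((tang_le_sq_norm e x).trans h1) ht
    (((le_abs_self _).trans (abs_inner_unit_le he x)).trans hx.le)
  unfold barrierFun at this
  nlinarith [mul_nonneg hN (sq_nonneg ⟪e, x⟫)]

lemma tang_reflection_le (he : ‖e‖ = 1) {x y : E} {t : ℝ} (hx : ⟪e, x⟫ = t) (hy : ⟪e, y⟫ = t) :
    ‖y - x‖ ^ 2 ≤ 2 * tang e y + 2 * tang e x ∧
      tang e (x - (y - x)) ≤ 8 * tang e x + 2 * tang e y := by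
  have hpn : ‖x - t • e‖ ^ 2 = tang e x := by rw [← sq_norm_sub_inner_smul he x, hx]
  have hqn : ‖y - t • e‖ ^ 2 = tang e y := by rw [← sq_norm_sub_inner_smul he y, hy]
  have hik : ⟪e, x - (y - x)⟫ = t := by rw [inner_sub_right, inner_sub_right, hx, hy]; ring
  have hrefl : tang e (x - (y - x)) = ‖(2 : ℝ) • (x - t • e) - (y - t • e)‖ ^ 2 := by
    rw [← sq_norm_sub_inner_smul he, hik]
    congr 2
    module
  have hkpq : y - x = (y - t • e) - (x - t • e) := by abel
  rw [hrefl, hkpq, ← hpn, ← hqn]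
  generalize x - t • e = p
  generalize y - t • e = q
  have e1 : ‖(2 : ℝ) • p‖ = 2 * ‖p‖ := by rw [norm_smul]; norm_num
  constructor
  · nlinarith [parallelogram_law_with_norm ℝ q p, sq_nonneg ‖q + p‖]
  · have := parallelogram_law_with_norm ℝ ((2 : ℝ) • p) q
    rw [e1] at this
    nlinarith [sq_nonneg ‖(2 : ℝ) • p + q‖]

/-- The extremal slope of a tangentially semiconvex function `W` controls the slopes of any
`U ≤ -W` satisfying the barrier property. -/
lemma mem_Adm_of_neg_sInf_lt (he : ‖e‖ = 1) {U W : E → ℝ} {r C δ : ℝ} (hr : 0 < r)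
    (hδ : 0 < δ)
    (hUW : ∀ x ∈ ball (0 : E) r, 0 ≤ ⟪e, x⟫ → U x + W x ≤ 0)
    (hUΓ : ∀ x ∈ ball (0 : E) r, ⟪e, x⟫ = 0 → U x ≤ C * tang e x)
    (hWΓ : ∀ x ∈ ball (0 : E) r, ⟪e, x⟫ = 0 → W x ≤ C * tang e x)
    (hsc : ∀ x τ, ⟪e, τ⟫ = 0 → x ∈ ball (0 : E) r → x + τ ∈ ball (0 : E) r →
      x - τ ∈ ball (0 : E) r → 2 * W x ≤ W (x + τ) + W (x - τ) + 2 * C * ‖τ‖ ^ 2)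
    (hUne : (Adm U e).Nonempty) (hWne : (Adm W e).Nonempty) (hWbdd : BddBelow (Adm W e))
    (hbar : ∀ s, -sInf (Adm W e) < s → s < -sInf (Adm W e) + δ → Barrier U e s)
    {σ : ℝ} (hσ : -sInf (Adm W e) < σ) : σ ∈ Adm U e := by
  set ω := sInf (Adm W e) with hω
  obtain ⟨θ, hθ, hθ1, hθ2⟩ : ∃ θ > 0, 4 * θ < σ + ω ∧ 3 * θ < δ :=
    ⟨min (σ + ω) δ / 5, div_pos (lt_min (by linarith) hδ) (by norm_num),
      by linarith [min_le_left (σ + ω) δ], by linarith [min_le_right (σ + ω) δ]⟩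
  obtain ⟨s0, ρU, hρU, C₀, hU0⟩ := hUne
  obtain ⟨s', hs', hs'ω⟩ := exists_lt_of_csInf_lt hWne (lt_add_of_pos_right ω hθ)
  obtain ⟨ρW, hρW, C', hC', hW0⟩ := Adm.exists_const he hs' hs'ω.le (max C 0)
  have hCC' : C ≤ C' := (le_max_left _ _).trans hC'
  have h0C' : 0 ≤ C' := (le_max_right _ _).trans hC'
  set D := |C| with hD
  have hCD : C ≤ D := le_abs_self C
  have hD0 : 0 ≤ D := abs_nonneg C
  have hs1 : ω - θ ∉ Adm W e := notMem_of_lt_csInf (by linarith : ω - θ < ω) hWbdd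
  set μ := max (2 * C' + 4 * D) (C₀ + 1) with hμ
  have hμ1 : 2 * C' + 4 * D ≤ μ := le_max_left _ _
  have hμ2 : C₀ + 1 ≤ μ := le_max_right _ _
  have hμ0 : 0 ≤ μ := by linarith
  obtain ⟨N, hN, ρ₀, hρ₀, HN⟩ := hbar (-ω + 3 * θ) (by linarith) (by linarith) μ hμ0
  obtain ⟨ρ, hρ, hρ1, hρ2, hρ3, hρ4⟩ : ∃ ρ > 0, ρ < ρ₀ ∧ 4 * ρ < r ∧ 4 * ρ < ρU ∧
      4 * ρ < ρW := by
    refine ⟨min (min ρ₀ r) (min ρU ρW) / 5, by positivity, ?_, ?_, ?_, ?_⟩ <;>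
    linarith [min_le_left (min ρ₀ r) (min ρU ρW), min_le_right (min ρ₀ r) (min ρU ρW),
      min_le_left ρ₀ r, min_le_right ρ₀ r, min_le_left ρU ρW, min_le_right ρU ρW,
      lt_min hρ₀ hr, lt_min hρU hρW]
  obtain ⟨t0, ht0, ht1, ht2, ht3⟩ : ∃ t0 > 0, t0 < ρ ∧ |s0 - (-ω + 3 * θ)| * t0 ≤ ρ ^ 2 ∧
      N * t0 ≤ θ := by
    refine ⟨min (ρ / 2) (min (ρ ^ 2 / (|s0 - (-ω + 3 * θ)| + 1)) (θ / (N + 1))),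
      by positivity, ?_, ?_, ?_⟩
    · exact (min_le_left _ _).trans_lt (by linarith)
    · have h1 : min (ρ / 2) (min (ρ ^ 2 / (|s0 - (-ω + 3 * θ)| + 1)) (θ / (N + 1))) ≤
        ρ ^ 2 / (|s0 - (-ω + 3 * θ)| + 1) := (min_le_right _ _).trans (min_le_left _ _)
      rw [le_div_iff₀ (by positivity)] at h1
      have : 0 < min (ρ / 2) (min (ρ ^ 2 / (|s0 - (-ω + 3 * θ)| + 1)) (θ / (N + 1))) := by
        positivity
      linarith
    · have h1 : min (ρ / 2) (min (ρ ^ 2 / (|s0 - (-ω + 3 * θ)| + 1)) (θ / (N + 1))) ≤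
        θ / (N + 1) := (min_le_right _ _).trans (min_le_right _ _)
      rw [le_div_iff₀ (by positivity)] at h1
      have : 0 < min (ρ / 2) (min (ρ ^ 2 / (|s0 - (-ω + 3 * θ)| + 1)) (θ / (N + 1))) := by
        positivity
      linarith
  obtain ⟨xk, hxk, htk, hWk⟩ : ∃ x ∈ ball (0 : E) t0, 0 ≤ ⟪e, x⟫ ∧
      (ω - θ) * ⟪e, x⟫ + (4 * C' + 2 * D) * tang e x < W x := by
    by_contra! hcon
    exact hs1 ⟨t0, ht0, 4 * C' + 2 * D, hcon⟩
  rw [mem_ball_zero_iff] at hxk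
  have htang := tang_nonneg he xk
  have htk' : 0 < ⟪e, xk⟫ := by
    rcases htk.eq_or_lt with h | h
    · have h1 := hWΓ xk (by simp; linarith) h.symm
      rw [← h] at hWk
      nlinarith
    · exact h
  obtain ⟨t, ht⟩ : ∃ t, ⟪e, xk⟫ = t := ⟨_, rfl⟩
  rw [ht] at htk htk' hWk
  have htt0 : t < t0 := ht ▸ ((le_abs_self _).trans (abs_inner_unit_le he xk)).trans_lt hxk
  have hlow : ∀ y, ‖y‖ ≤ 2 * ρ → ⟪e, y⟫ = t →
      (ω - 3 * θ) * t - (2 * C' + 4 * D) * tang e y ≤ W y := by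
    intro y hy hyt
    have hek : ⟪e, y - xk⟫ = 0 := by rw [inner_sub_right, hyt, ht, sub_self]
    have hkn : ‖y - xk‖ ≤ 3 * ρ := (norm_sub_le _ _).trans (by linarith)
    have hxkk : ‖xk - (y - xk)‖ ≤ 4 * ρ := (norm_sub_le _ _).trans (by linarith)
    have h1 := hsc xk (y - xk) hek (by simp; linarith) (by simp; linarith) (by simp; linarith)
    rw [add_sub_cancel] at h1
    have hik : ⟪e, xk - (y - xk)⟫ = t := by rw [inner_sub_right, hek, sub_zero, ht]
    have h2 := hW0 (xk - (y - xk)) (by simp; linarith) (by rw [hik]; exact htk)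
    rw [hik] at h2
    have h6 := mul_le_mul_of_nonneg_right hCD (sq_nonneg ‖y - xk‖)
    obtain ⟨hk2, hr2⟩ := tang_reflection_le he ht hyt
    have h3 := mul_le_mul_of_nonneg_left hr2 h0C'
    have h4 := mul_le_mul_of_nonneg_left hk2 hD0
    linarith
  have htop : ∀ y, ‖y‖ ≤ 2 * ρ → ⟪e, y⟫ = t → U y ≤ (-ω + 3 * θ) * t + μ * tang e y := by
    intro y hy hyt
    have h1 := hlow y hy hyt
    have h2 := hUW y (by simp; linarith) (by rw [hyt]; exact htk)
    have h3 := mul_le_mul_of_nonneg_right hμ1 (tang_nonneg he y)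
    linarith
  have hcomp := HN ρ ⟨hρ, hρ1⟩ t ⟨htk', by linarith⟩ (by
    intro x h1 h2 h3 hb
    have hxn := norm_le_of_mem_cylinder hρ.le htk h1 h2 h3
    have htn := tang_nonneg he x
    have p2 : 0 ≤ N * (t * ⟪e, x⟫ - ⟪e, x⟫ ^ 2) := mul_nonneg hN (by nlinarith)
    unfold barrierFun
    rcases hb with hb | hb | hb
    · have h4 := hUΓ x (by simp; linarith) hb
      have h5 := mul_le_mul_of_nonneg_right (show C ≤ μ by linarith) htn
      rw [hb] at p2 ⊢
      linarith
    · have h4 := htop x (by linarith) hb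
      rw [hb] at p2 ⊢
      linarith
    · have h4 := hU0 x (by simp; linarith) h2
      have h5 := le_abs_self (s0 - (-ω + 3 * θ))
      have h6 : (s0 - (-ω + 3 * θ)) * ⟪e, x⟫ ≤ ρ ^ 2 :=
        (mul_le_mul h5 (h3.trans htt0.le) h2 (abs_nonneg _)).trans ht2
      rw [hb] at h4 ⊢
      nlinarith [sq_nonneg ρ])
  refine ⟨t, htk', μ, fun x hx hxt => ?_⟩
  rw [mem_ball_zero_iff] at hx
  have h1 : ‖x‖ ^ 2 ≤ ρ ^ 2 := by gcongr; linarith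
  have h2 := hcomp x ((tang_le_sq_norm e x).trans h1) hxt
    (((le_abs_self _).trans (abs_inner_unit_le he x)).trans hx.le)
  unfold barrierFun at h2
  have h3 : N * t * ⟪e, x⟫ ≤ θ * ⟪e, x⟫ := by
    gcongr
    exact (mul_le_mul_of_nonneg_left htt0.le hN).trans ht3
  have h4 : 0 ≤ N * ⟪e, x⟫ ^ 2 := by positivity
  have h5 : (-ω + 4 * θ) * ⟪e, x⟫ ≤ σ * ⟪e, x⟫ := by
    gcongr
    linarith
  linarith

end Barriers

section Interface

variable {E : Type*} [NormedAddCommGroup E] [InnerProductSpace ℝ E] {e : E}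

lemma Ell.shift {lam C : ℝ} {G : (E →L[ℝ] E) → E → ℝ} (h : Ell e lam C G) (c : E) :
    Ell e lam C (fun T p => G T (p + c)) := by
  intro T p q α β hα hβ
  have := h T (p + c) q α β hα hβ
  rwa [add_right_comm] at this

lemma norm_sub_inner_smul_le (he : ‖e‖ = 1) (x : E) : ‖x - ⟪e, x⟫ • e‖ ≤ ‖x‖ := by
  refine le_of_sq_le_sq ?_ (norm_nonneg _)
  rw [sq_norm_sub_inner_smul he]
  exact tang_le_sq_norm e x

lemma inner_sub_inner_smul (he : ‖e‖ = 1) (x : E) : ⟪e, x - ⟪e, x⟫ • e⟫ = 0 := by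
  rw [inner_sub_right, real_inner_smul_right, inner_self_unit he, mul_one, sub_self]

lemma Adm_of_normal_lipschitz (he : ‖e‖ = 1) {f : E → ℝ} {r C K : ℝ} (hr : 0 < r)
    (hf0 : f 0 = 0)
    (hΓ : ∀ x ∈ ball (0 : E) r, ⟪e, x⟫ = 0 → f x ≤ C * tang e x)
    (hlip : ∀ x ∈ ball (0 : E) r, 0 ≤ ⟪e, x⟫ → |f x - f (x - ⟪e, x⟫ • e)| ≤ K * ⟪e, x⟫) :
    (Adm f e).Nonempty ∧ BddBelow (Adm f e) := by
  constructor
  · refine ⟨K, r, hr, C, fun x hx ht => ?_⟩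
    have h1 := (abs_le.1 (hlip x hx ht)).2
    have h2 := hΓ (x - ⟪e, x⟫ • e) (by
      rw [mem_ball_zero_iff] at hx ⊢
      exact (norm_sub_inner_smul_le he x).trans_lt hx) (inner_sub_inner_smul he x)
    have h3 : tang e (x - ⟪e, x⟫ • e) = tang e x := by
      rw [← sq_norm_sub_inner_smul he x, sq_norm_eq_tang e (x - ⟪e, x⟫ • e),
        inner_sub_inner_smul he]
      ring
    rw [h3] at h2
    linarith
  · refine ⟨-K, ?_⟩
    rintro s ⟨ρ, hρ, C', hC'⟩
    obtain ⟨t, ht, ht1, ht2⟩ : ∃ t > 0, t < ρ ∧ t < r :=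
      ⟨min ρ r / 2, by positivity, by linarith [min_le_left ρ r, lt_min hρ hr],
        by linarith [min_le_right ρ r, lt_min hρ hr]⟩
    have hi : ⟪e, t • e⟫ = t := by rw [real_inner_smul_right, inner_self_unit he, mul_one]
    have hn : ‖t • e‖ = t := by rw [norm_smul, he, mul_one, Real.norm_of_nonneg ht.le]
    have h1 := hC' (t • e) (by rw [mem_ball_zero_iff, hn]; exact ht1) (by rw [hi]; exact ht.le)
    have h2 := (abs_le.1 (hlip (t • e) (by rw [mem_ball_zero_iff, hn]; exact ht2)
      (by rw [hi]; exact ht.le))).1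
    rw [hi, tang_smul_self he] at h1
    rw [hi, sub_self, hf0] at h2
    have h3 : -K * t ≤ s * t := by linarith
    exact le_of_mul_le_mul_right h3 ht

lemma superjet_of_two_sided_Adm (he : ‖e‖ = 1) {f : E → ℝ} {s : ℝ} (hf0 : f 0 = 0)
    (h1 : s ∈ Adm f e) (h2 : -s ∈ Adm f (-e)) : ∃ T, Superjet f 0 (s • e) T := by
  obtain ⟨ρ₁, hρ₁, C₁, -, H1⟩ := Adm.exists_const he h1 le_rfl 0
  obtain ⟨ρ₂, hρ₂, C₂, hC₂, H2⟩ := Adm.exists_const (by simpa using he) h2 le_rfl C₁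
  refine ⟨quadOp e (2 * C₂) (2 * C₂), quadOp_symm e _ _, ?_⟩
  filter_upwards [ball_mem_nhds (0 : E) hρ₁, ball_mem_nhds (0 : E) hρ₂] with y hy1 hy2
  rw [sub_zero, quadOp_inner, real_inner_smul_left, hf0]
  have htn := tang_nonneg he y
  have e1 : (2 * C₂ * ‖y‖ ^ 2 - 2 * C₂ * ⟪e, y⟫ ^ 2) / 2 = C₂ * tang e y := by
    unfold tang; ring
  rw [e1]
  rcases le_total 0 ⟪e, y⟫ with h | h
  · have := H1 y hy1 h
    have := mul_le_mul_of_nonneg_right hC₂ htn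
    linarith
  · have := H2 y hy2 (by rw [inner_neg_left]; linarith)
    rw [inner_neg_left, tang_neg_left] at this
    linarith

/-- Comparison at an interface point, for functions normalized to vanish at the origin. -/
lemma interface_normalized [FiniteDimensional ℝ E] (he : ‖e‖ = 1) {U W : E → ℝ}
    (hU : Continuous U) (hW : Continuous W) (hU0 : U 0 = 0) (hW0 : W 0 = 0)
    {r C K R A B lam L : ℝ} (hr : 0 < r) (hlam : 0 < lam) (hL : 0 ≤ L)
    {h : E → ℝ} (hh : Continuous h) {G : (E →L[ℝ] E) → E → ℝ} (hG : Ell e lam L G) (c : E)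
    (hUW : ∀ x ∈ ball (0 : E) r, U x + W x ≤ 0)
    (hUΓ : ∀ x ∈ ball (0 : E) r, ⟪e, x⟫ = 0 → U x ≤ C * tang e x)
    (hWΓ : ∀ x ∈ ball (0 : E) r, ⟪e, x⟫ = 0 → W x ≤ C * tang e x)
    (hsc : ∀ x τ, ⟪e, τ⟫ = 0 → x ∈ ball (0 : E) r → x + τ ∈ ball (0 : E) r →
      x - τ ∈ ball (0 : E) r → 2 * W x ≤ W (x + τ) + W (x - τ) + 2 * C * ‖τ‖ ^ 2)
    (hUlip : ∀ x ∈ ball (0 : E) r, ⟪e, x⟫ ≤ 0 → |U x - U (x - ⟪e, x⟫ • e)| ≤ K * -⟪e, x⟫)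
    (hWlip : ∀ x ∈ ball (0 : E) r, ⟪e, x⟫ ≤ 0 → |W x - W (x - ⟪e, x⟫ • e)| ≤ K * -⟪e, x⟫)
    (hUl : ∀ x ∈ ball (0 : E) r, ⟪e, x⟫ < 0 → ∀ b T, Superjet U x b T →
      ‖b + c‖ ≤ R ∧ h (b + c) ≤ A)
    (hWl : ∀ x ∈ ball (0 : E) r, ⟪e, x⟫ < 0 → ∀ b T, Superjet W x b T →
      ‖c - b‖ ≤ R ∧ B ≤ h (c - b))
    (hU0j : ∀ b T, Superjet U 0 b T → ‖b + c‖ ≤ R → h (b + c) ≤ A)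
    (hW0j : ∀ b T, Superjet W 0 b T → ‖c - b‖ ≤ R → B ≤ h (c - b))
    (hUr : ∀ x ∈ ball (0 : E) r, 0 < ⟪e, x⟫ → ∀ b T, Superjet U x b T → G T (b + c) ≤ A)
    (hWr : ∀ x ∈ ball (0 : E) r, 0 < ⟪e, x⟫ → ∀ b T, Superjet W x b T → B ≤ G (-T) (c - b)) :
    B ≤ A := by
  by_contra! hAB
  have he' : ‖-e‖ = 1 := by simpa using he
  obtain ⟨SU, hSU⟩ : ∃ S : Set E, S = {b | ‖b + c‖ ≤ R ∧ h (b + c) ≤ A} := ⟨_, rfl⟩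
  obtain ⟨SW, hSW⟩ : ∃ S : Set E, S = {b | ‖c - b‖ ≤ R ∧ B ≤ h (c - b)} := ⟨_, rfl⟩
  have hSUc : IsClosed SU := by
    have h1 : Continuous fun b : E => ‖b + c‖ := by fun_prop
    have h2 : Continuous fun b : E => h (b + c) := by fun_prop
    rw [hSU]
    exact (isClosed_le h1 continuous_const).inter (isClosed_le h2 continuous_const)
  have hSWc : IsClosed SW := by
    have h1 : Continuous fun b : E => ‖c - b‖ := by fun_prop
    have h2 : Continuous fun b : E => h (c - b) := by fun_prop
    rw [hSW]
    exact (isClosed_le h1 continuous_const).inter (isClosed_le continuous_const h2)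
  have hUΓ' : ∀ x ∈ ball (0 : E) r, ⟪-e, x⟫ = 0 → U x ≤ C * tang (-e) x := by
    intro x hx ht
    rw [inner_neg_left, neg_eq_zero] at ht
    rw [tang_neg_left]; exact hUΓ x hx ht
  have hWΓ' : ∀ x ∈ ball (0 : E) r, ⟪-e, x⟫ = 0 → W x ≤ C * tang (-e) x := by
    intro x hx ht
    rw [inner_neg_left, neg_eq_zero] at ht
    rw [tang_neg_left]; exact hWΓ x hx ht
  have hUj' : ∀ x ∈ ball (0 : E) r, 0 < ⟪-e, x⟫ → ∀ b T, Superjet U x b T → b ∈ SU := by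
    intro x hx ht b T hj
    rw [inner_neg_left, neg_pos] at ht
    rw [hSU]; exact hUl x hx ht b T hj
  have hWj' : ∀ x ∈ ball (0 : E) r, 0 < ⟪-e, x⟫ → ∀ b T, Superjet W x b T → b ∈ SW := by
    intro x hx ht b T hj
    rw [inner_neg_left, neg_pos] at ht
    rw [hSW]; exact hWl x hx ht b T hj
  obtain ⟨hUne, hUbd⟩ := Adm_of_normal_lipschitz (K := K) he' hr hU0 hUΓ' (by
    intro x hx ht
    rw [inner_neg_left] at ht ⊢
    simpa using hUlip x hx (by linarith))
  obtain ⟨hWne, hWbd⟩ := Adm_of_normal_lipschitz (K := K) he' hr hW0 hWΓ' (by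
    intro x hx ht
    rw [inner_neg_left] at ht ⊢
    simpa using hWlip x hx (by linarith))
  have hα := sInf_Adm_smul_mem he' hU hr hSUc hUΓ' hUj' hUne hUbd
  have hβ := sInf_Adm_smul_mem he' hW hr hSWc hWΓ' hWj' hWne hWbd
  obtain ⟨α, hαdef⟩ : ∃ α, sInf (Adm U (-e)) = α := ⟨_, rfl⟩
  obtain ⟨β, hβdef⟩ : ∃ β, sInf (Adm W (-e)) = β := ⟨_, rfl⟩
  rw [hαdef] at hα
  rw [hβdef] at hβ
  set k : ℝ → E := fun s => c + s • e with hk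
  have hkc : Continuous k := by simp only [hk]; fun_prop
  have hα' : ‖k (-α)‖ ≤ R ∧ h (k (-α)) ≤ A := by
    rw [hSU] at hα
    have e1 : α • -e + c = k (-α) := by simp only [hk]; module
    simpa only [mem_ofPred_eq, e1] using hα
  have hβ' : ‖k β‖ ≤ R ∧ B ≤ h (k β) := by
    rw [hSW] at hβ
    have e1 : c - β • -e = k β := by simp only [hk]; module
    simpa only [mem_ofPred_eq, e1] using hβ
  have hle : β ≤ -α := by
    have hev : ∀ᶠ s in 𝓝 (-β), A < h (k (-s)) := by
      have h1 : Tendsto (fun s => h (k (-s))) (𝓝 (-β)) (𝓝 (h (k (- -β)))) :=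
        Continuous.tendsto (by fun_prop) _
      exact h1.eventually_const_lt (by rw [neg_neg]; linarith)
    obtain ⟨δ, hδ, hδ'⟩ := Metric.eventually_nhds_iff.1 hev
    have hadm : ∀ σ, -β < σ → σ ∈ Adm U (-e) := by
      intro σ hσ
      refine mem_Adm_of_neg_sInf_lt he' hr hδ (fun x hx _ => hUW x hx) hUΓ' hWΓ' ?_ hUne hWne
        hWbd ?_ (by rwa [hβdef])
      · intro x τ hτ
        rw [inner_neg_left, neg_eq_zero] at hτ
        exact hsc x τ hτ
      · intro s hs1 hs2
        rw [hβdef] at hs1 hs2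
        refine barrier_firstOrder he' hU hr hSUc hUj' ?_
        have h1 := hδ' (y := s) (by rw [Real.dist_eq, abs_lt]; constructor <;> linarith)
        rw [hSU]
        rintro ⟨-, h2⟩
        have e1 : s • -e + c = k (-s) := by simp only [hk]; module
        rw [e1] at h2
        linarith
    have : α ≤ -β := by
      rw [← hαdef]
      refine le_of_forall_gt fun σ hσ => ?_
      obtain ⟨σ', h1, h2⟩ := exists_between hσ
      exact (csInf_le hUbd (hadm σ' h1)).trans_lt h2
    linarith
  obtain ⟨s₀, ⟨hs1, hs2⟩, hs₀⟩ := intermediate_value_Icc' (f := fun s => h (k s)) hle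
    (by fun_prop) (show (A + B) / 2 ∈ Icc (h (k (-α))) (h (k β)) from
      ⟨by linarith, by linarith⟩)
  simp only at hs₀
  have hs1' : β < s₀ := lt_of_le_of_ne hs1 (by rintro rfl; linarith [hβ'.2])
  have hs2' : s₀ < -α := lt_of_le_of_ne hs2 (by rintro rfl; linarith [hα'.2])
  have hev : ∀ᶠ s in 𝓝 s₀, β < s ∧ s < -α ∧ A < h (k s) ∧ h (k s) < B := by
    have h1 : Tendsto (fun s => h (k s)) (𝓝 s₀) (𝓝 (h (k s₀))) :=
      Continuous.tendsto (by fun_prop) _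
    filter_upwards [lt_mem_nhds hs1', gt_mem_nhds hs2',
      h1.eventually_const_lt (show A < h (k s₀) by linarith),
      h1.eventually_lt_const (show h (k s₀) < B by linarith)] with s a1 a2 a3 a4
    exact ⟨a1, a2, a3, a4⟩
  obtain ⟨δ, hδ, hδ'⟩ := Metric.eventually_nhds_iff.1 hev
  have hnorm : ∀ s, β ≤ s → s ≤ -α → ‖k s‖ ≤ R := by
    intro s h1 h2
    have hconv : Convex ℝ {s : ℝ | ‖k s‖ ≤ R} := by
      have h3 : {s : ℝ | ‖k s‖ ≤ R} = (AffineMap.lineMap c (c + e) : ℝ →ᵃ[ℝ] E) ⁻¹'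
          closedBall 0 R := by
        ext s
        simp only [hk, mem_ofPred_eq, mem_preimage, mem_closedBall_zero_iff,
          AffineMap.lineMap_apply, vsub_eq_sub, vadd_eq_add, add_sub_cancel_left]
        rw [add_comm]
      rw [h3]
      exact (convex_closedBall 0 R).affine_preimage _
    exact hconv.ordConnected.out hβ'.1 hα'.1 ⟨h1, h2⟩
  have hprop : ∀ s, dist s s₀ < δ → s ∉ Adm U e ∧ -s ∉ Adm W e := by
    intro s hs
    obtain ⟨a1, a2, a3, a4⟩ := hδ' hs
    have hn := hnorm s a1.le a2.le
    constructor
    · intro hmem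
      obtain ⟨T, hT⟩ := superjet_of_two_sided_Adm he hU0 hmem
        (mem_Adm_of_sInf_lt he' hUne (by rw [hαdef]; linarith))
      have e1 : s • e + c = k s := by simp only [hk]; module
      have := hU0j _ _ hT (by rwa [e1])
      rw [e1] at this
      linarith
    · intro hmem
      obtain ⟨T, hT⟩ := superjet_of_two_sided_Adm he hW0 hmem
        (mem_Adm_of_sInf_lt he' hWne (by rw [hβdef]; linarith))
      have e1 : c - -s • e = k s := by simp only [hk]; module
      have := hW0j _ _ hT (by rwa [e1])
      rw [e1] at this
      linarith
  have hGU := hG.shift c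
  have hGW := hG.mirror.shift (-c)
  have hWr' : ∀ x ∈ ball (0 : E) r, 0 < ⟪e, x⟫ → ∀ b T, Superjet W x b T →
      -G (-T) (-(b + -c)) ≤ -B := by
    intro x hx ht b T hj
    have e1 : -(b + -c) = c - b := by abel
    rw [e1]
    linarith [hWr x hx ht b T hj]
  have hUne' := Adm_nonempty_secondOrder he hU hr hlam hL hGU hUr hUΓ
  have hWne' := Adm_nonempty_secondOrder he hW hr hlam hL hGW hWr' hWΓ
  have hlb : ∀ s, dist s s₀ < δ → -s ∈ lowerBounds (Adm W e) := by
    intro s hs σ hσ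
    by_contra! hlt
    exact (hprop s hs).2 (Adm.mono he hσ hlt.le)
  have hd0 : dist s₀ s₀ < δ := by simpa using hδ
  have hbd' : BddBelow (Adm W e) := ⟨_, hlb s₀ hd0⟩
  obtain ⟨ρ₀, hρ₀, Hbar⟩ := barrier_secondOrder he hU hr hlam hL hGU hUr
  have hmem : ∀ σ, -sInf (Adm W e) < σ → σ ∈ Adm U e := fun σ hσ =>
    mem_Adm_of_neg_sInf_lt he hr one_pos (fun x hx _ => hUW x hx) hUΓ hWΓ hsc hUne' hWne' hbd'
      (fun s _ _ μ hμ => by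
        obtain ⟨N, hN, HN⟩ := Hbar s μ hμ
        exact ⟨N, hN, ρ₀, hρ₀, HN⟩) hσ
  have k1 : s₀ + δ / 2 ≤ -sInf (Adm W e) := by
    by_contra! hlt
    exact (hprop _ (by rw [Real.dist_eq, abs_lt]; constructor <;> linarith)).1 (hmem _ hlt)
  have k2 : -s₀ ≤ sInf (Adm W e) := le_csInf hWne' (hlb s₀ hd0)
  linarith

end Interface

section Tangential

variable {E : Type*} [NormedAddCommGroup E] [InnerProductSpace ℝ E] {e : E}

/-- Frozen interface inequalities for a sub-solution, in terms of superjets. -/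
def InterfaceJet (e : E) (h : E → ℝ) (G : (E →L[ℝ] E) → E → ℝ) (A R R' : ℝ) (S : Set E)
    (u : E → ℝ) : Prop :=
  ∀ x ∈ S, ∀ b T, Superjet u x b T →
    (⟪e, x⟫ < 0 → ‖b‖ ≤ R ∧ h b ≤ A) ∧ (⟪e, x⟫ = 0 → ‖b‖ ≤ R' → h b ≤ A) ∧
      (0 < ⟪e, x⟫ → G T b ≤ A)

/-- Lipschitz continuity in the normal direction below the interface. -/
def NormalLip (e : E) (K : ℝ) (S : Set E) (u : E → ℝ) : Prop :=
  ∀ x ∈ S, ⟪e, x⟫ ≤ 0 → |u x - u (x - ⟪e, x⟫ • e)| ≤ K * -⟪e, x⟫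

lemma Superjet.of_translate {u : E → ℝ} {z c y b : E} {T : E →L[ℝ] E} {m : ℝ}
    (h : Superjet (fun y => u (z + y) - m - ⟪c, y⟫) y b T) : Superjet u (z + y) (b + c) T := by
  refine ⟨h.1, ?_⟩
  have ht : Tendsto (fun x => x - z) (𝓝 (z + y)) (𝓝 y) := by
    have : Continuous fun x : E => x - z := by fun_prop
    simpa using this.tendsto (z + y)
  filter_upwards [ht.eventually h.2] with x hx
  have e1 : z + (x - z) = x := by abel
  have e2 : x - z - y = x - (z + y) := by abel
  rw [e1, e2] at hx
  have e3 : ⟪c, x - z⟫ = ⟪c, y⟫ + ⟪c, x - (z + y)⟫ := by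
    rw [← inner_add_right]; congr 1; abel
  rw [e3] at hx
  rw [inner_add_left]
  linarith

/-- Sup-convolution in the directions orthogonal to `e`. -/
lemma exists_tangential_sup [FiniteDimensional ℝ E] (he : ‖e‖ = 1) {u : E → ℝ}
    (hu : Continuous u) {z : E} (hz : ⟪e, z⟫ = 0) {ρ σ a N : ℝ} (hρ : 0 < ρ) (hσ : 0 < σ)
    (hσρ : σ ≤ ρ / 4) (ha : 0 < a) (hN : ∀ y ∈ closedBall z (2 * ρ), |u y| ≤ N)
    (haN : 2 * N ≤ a * σ ^ 2) :
    ∃ (U : E → ℝ) (p : E → E), Continuous U ∧ (∀ x ∈ ball z (ρ / 2), u x ≤ U x) ∧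
      (∀ x, U x ≤ u (p x)) ∧ (∀ x, ⟪e, p x⟫ = ⟪e, x⟫) ∧
      (∀ x ∈ ball z (ρ / 2), ‖p x - x‖ ≤ σ) ∧
      (∀ x ∈ ball z (ρ / 2), ∀ b T, Superjet U x b T → Superjet u (p x) b T) ∧
      (∀ K, NormalLip e K (ball z ρ) u → NormalLip e K (ball z (ρ / 2)) U) ∧
      ∀ x, ∃ ξ : E, ⟪e, ξ⟫ = 0 ∧ ∀ y, ⟪e, y⟫ = ⟪e, x⟫ →
        U x + ⟪ξ, y - x⟫ - a * ‖y - x‖ ^ 2 ≤ U y := by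
  obtain ⟨D, hD⟩ : ∃ D : Set E, D = {q | ⟪e, q⟫ = 0 ∧ ‖q - z‖ ≤ ρ} := ⟨_, rfl⟩
  have hDc : IsCompact D := by
    refine (isCompact_closedBall z ρ).of_isClosed_subset ?_ ?_
    · rw [hD]
      have h1 : Continuous fun q : E => ⟪e, q⟫ := by fun_prop
      have h2 : Continuous fun q : E => ‖q - z‖ := by fun_prop
      exact (isClosed_eq h1 continuous_const).inter (isClosed_le h2 continuous_const)
    · intro q hq
      rw [hD] at hq
      rw [mem_closedBall, dist_eq_norm]; exact hq.2
  have hDne : D.Nonempty := ⟨z, by rw [hD]; exact ⟨hz, by simpa using hρ.le⟩⟩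
  obtain ⟨g, hg⟩ : ∃ g : E → E → ℝ, g = fun x q =>
    u (q + ⟪e, x⟫ • e) - a * ‖x - ⟪e, x⟫ • e - q‖ ^ 2 := ⟨_, rfl⟩
  have hgc : Continuous (fun y : E × E => g y.1 y.2) := by
    rw [hg]; fun_prop
  have hgc' : ∀ x, Continuous (g x) := fun x => by
    rw [hg]; fun_prop
  have hatt : ∀ x, ∃ q ∈ D, ∀ q' ∈ D, g x q' ≤ g x q := fun x =>
    hDc.exists_isMaxOn hDne (hgc' x).continuousOn
  choose q hqD hqmax using hatt
  have hUc : Continuous fun x => g x (q x) := by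
    have h1 : (fun x => g x (q x)) = fun x => sSup ((fun y => g x y) '' D) := by
      funext x
      symm
      refine IsGreatest.csSup_eq ⟨⟨q x, hqD x, rfl⟩, ?_⟩
      rintro _ ⟨y, hy, rfl⟩
      exact hqmax x y hy
    rw [h1]
    exact IsCompact.continuous_sSup (f := g) hDc hgc
  have hee := inner_self_unit he
  have hqD1 : ∀ x, ⟪e, q x⟫ = 0 := fun x => by have := hqD x; rw [hD] at this; exact this.1
  have hqD2 : ∀ x, ‖q x - z‖ ≤ ρ := fun x => by have := hqD x; rw [hD] at this; exact this.2
  have hPD : ∀ x, ‖x - z‖ ≤ ρ → x - ⟪e, x⟫ • e ∈ D := by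
    intro x hx
    rw [hD]
    refine ⟨inner_sub_inner_smul he x, ?_⟩
    have h1 := norm_sub_inner_smul_le he (x - z)
    rw [inner_sub_right, hz, sub_zero] at h1
    have e1 : x - ⟪e, x⟫ • e - z = x - z - ⟪e, x⟫ • e := by abel
    rw [e1]; exact h1.trans hx
  have hip : ∀ x, ⟪e, q x + ⟪e, x⟫ • e⟫ = ⟪e, x⟫ := by
    intro x
    rw [inner_add_right, real_inner_smul_right, hee, hqD1]; ring
  have hclose : ∀ x ∈ ball z (ρ / 2), ‖x - ⟪e, x⟫ • e - q x‖ ≤ σ := by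
    intro x hx
    rw [mem_ball, dist_eq_norm] at hx
    have hmax := hqmax x _ (hPD x (by linarith))
    have hin : |⟪e, x⟫| ≤ ρ / 2 := by
      have := abs_inner_unit_le he (x - z)
      rw [inner_sub_right, hz, sub_zero] at this
      linarith
    have hb1 := hN (q x + ⟪e, x⟫ • e) (by
      rw [mem_closedBall, dist_eq_norm]
      have e1 : q x + ⟪e, x⟫ • e - z = (q x - z) + ⟪e, x⟫ • e := by abel
      rw [e1]
      refine (norm_add_le _ _).trans ?_
      rw [norm_smul, he, Real.norm_eq_abs]
      have := hqD2 x
      linarith)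
    have hb2 := hN x (by rw [mem_closedBall, dist_eq_norm]; linarith)
    rw [hg] at hmax
    simp only [sub_add_cancel, sub_self, norm_zero] at hmax
    rw [abs_le] at hb1 hb2
    have h3 : a * ‖x - ⟪e, x⟫ • e - q x‖ ^ 2 ≤ a * σ ^ 2 := by nlinarith
    exact le_of_sq_le_sq (le_of_mul_le_mul_left h3 ha) hσ.le
  refine ⟨fun x => g x (q x), fun x => q x + ⟪e, x⟫ • e, hUc, ?_, ?_, hip, ?_, ?_, ?_, ?_⟩
  · intro x hx
    rw [mem_ball, dist_eq_norm] at hx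
    have hmax := hqmax x _ (hPD x (by linarith))
    refine le_trans ?_ hmax
    rw [hg]
    simp
  · intro x
    rw [hg]
    have : 0 ≤ a * ‖x - ⟪e, x⟫ • e - q x‖ ^ 2 := by positivity
    simp only
    linarith
  · intro x hx
    have e1 : q x + ⟪e, x⟫ • e - x = -(x - ⟪e, x⟫ • e - q x) := by abel
    simp only [e1, norm_neg]
    exact hclose x hx
  · intro x hx b T hj
    refine ⟨hj.1, ?_⟩
    have hcl := hclose x hx
    rw [mem_ball, dist_eq_norm] at hx
    have ht : Tendsto (fun y => x + (y - (q x + ⟪e, x⟫ • e))) (𝓝 (q x + ⟪e, x⟫ • e)) (𝓝 x) := by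
      have : Continuous fun y => x + (y - (q x + ⟪e, x⟫ • e)) := by fun_prop
      simpa using this.tendsto (q x + ⟪e, x⟫ • e)
    have hnear : ball (q x + ⟪e, x⟫ • e) (ρ / 4) ∈ 𝓝 (q x + ⟪e, x⟫ • e) :=
      ball_mem_nhds _ (by positivity)
    filter_upwards [ht.eventually hj.2, hnear] with y hy hy'
    rw [mem_ball, dist_eq_norm] at hy'
    obtain ⟨x', hx'⟩ : ∃ x', x' = x + (y - (q x + ⟪e, x⟫ • e)) := ⟨_, rfl⟩
    rw [← hx'] at hy
    have e1 : x' - x = y - (q x + ⟪e, x⟫ • e) := by rw [hx']; abel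
    have e2 : ⟪e, x'⟫ = ⟪e, y⟫ := by
      rw [hx', inner_add_right, inner_sub_right, hip]; ring
    have hyz : ‖y - z‖ ≤ ρ := by
      have e3 : y - z = (y - (q x + ⟪e, x⟫ • e)) - (x - ⟪e, x⟫ • e - q x) + (x - z) := by abel
      rw [e3]
      refine (norm_add_le _ _).trans ?_
      have := norm_sub_le (y - (q x + ⟪e, x⟫ • e)) (x - ⟪e, x⟫ • e - q x)
      linarith
    have hmax := hqmax x' _ (hPD y hyz)
    rw [e1] at hy
    have e4 : x' - ⟪e, x'⟫ • e - (y - ⟪e, y⟫ • e) = x - ⟪e, x⟫ • e - q x := by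
      rw [e2, hx']; abel
    have hl : g x' (y - ⟪e, y⟫ • e) = u y - a * ‖x - ⟪e, x⟫ • e - q x‖ ^ 2 := by
      rw [e2] at e4
      rw [hg]; simp only [e2, e4, sub_add_cancel]
    have hr : g x (q x) = u (q x + ⟪e, x⟫ • e) - a * ‖x - ⟪e, x⟫ • e - q x‖ ^ 2 := by
      rw [hg]
    rw [hl] at hmax
    rw [hr] at hy
    linarith
  · intro K hK x hx ht
    obtain ⟨P, hP⟩ : ∃ P, P = x - ⟪e, x⟫ • e := ⟨_, rfl⟩
    have hP0 : ⟪e, P⟫ = 0 := by rw [hP]; exact inner_sub_inner_smul he x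
    have hcl := hclose x hx
    have hPb : P ∈ ball z (ρ / 2) := by
      rw [mem_ball, dist_eq_norm] at hx ⊢
      have h1 := norm_sub_inner_smul_le he (x - z)
      rw [inner_sub_right, hz, sub_zero] at h1
      have e1 : P - z = x - z - ⟪e, x⟫ • e := by rw [hP]; abel
      rw [e1]; exact h1.trans_lt hx
    have hcl2 := hclose P hPb
    rw [hP0, zero_smul, sub_zero] at hcl2
    rw [← hP] at hcl ⊢
    have hxz : ‖x - z‖ < ρ / 2 := by rw [mem_ball, dist_eq_norm] at hx; exact hx
    have hgen : ∀ s, ⟪e, s⟫ = 0 → ‖P - s‖ ≤ σ →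
        |u (s + ⟪e, x⟫ • e) - u s| ≤ K * -⟪e, x⟫ := by
      intro s hs hPs
      have e1 : ⟪e, s + ⟪e, x⟫ • e⟫ = ⟪e, x⟫ := by
        rw [inner_add_right, real_inner_smul_right, hee, hs]; ring
      have := hK (s + ⟪e, x⟫ • e) (by
        rw [mem_ball, dist_eq_norm]
        have e2 : s + ⟪e, x⟫ • e - z = (x - z) - (P - s) := by rw [hP]; abel
        rw [e2]
        have := norm_sub_le (x - z) (P - s)
        linarith) (by rw [e1]; exact ht)
      rwa [e1, add_sub_cancel_right] at this
    have k1 := hgen (q x) (hqD1 x) hcl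
    have k2 := hgen (q P) (hqD1 P) hcl2
    have m1 := hqmax x (q P) (hqD P)
    have m2 := hqmax P (q x) (hqD x)
    rw [hg] at m1 m2 ⊢
    simp only [hP0, zero_smul, sub_zero, add_zero, ← hP] at m1 m2 ⊢
    rw [abs_le] at k1 k2 ⊢
    constructor <;> linarith [k1.1, k1.2, k2.1, k2.2]
  · intro x
    refine ⟨(2 * a) • (q x - (x - ⟪e, x⟫ • e)), ?_, ?_⟩
    · rw [real_inner_smul_right, inner_sub_right, hqD1, inner_sub_inner_smul he]; ring
    · intro y hy
      have m := hqmax y (q x) (hqD x)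
      refine le_trans ?_ m
      have e1 : y - ⟪e, x⟫ • e - q x = (x - ⟪e, x⟫ • e - q x) + (y - x) := by abel
      have e2 : q x - (x - ⟪e, x⟫ • e) = -(x - ⟪e, x⟫ • e - q x) := by abel
      rw [hg]
      simp only [hy]
      rw [e1, norm_add_sq_real, real_inner_smul_left, e2, inner_neg_left]
      linarith

end Tangential

section InterfacePoint

variable {E : Type*} [NormedAddCommGroup E] [InnerProductSpace ℝ E] {e : E}

/-- Comparison at a maximum on the interface of semiconvex functions. -/
lemma interface_semiconvex [FiniteDimensional ℝ E] (he : ‖e‖ = 1) {U W : E → ℝ}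
    (hU : Continuous U) (hW : Continuous W) {z : E} (hz : ⟪e, z⟫ = 0)
    {r a K K' R A B lam L : ℝ} (hr : 0 < r) (hlam : 0 < lam) (hL : 0 ≤ L) (ha : 0 < a)
    {h : E → ℝ} (hh : Continuous h) {G : (E →L[ℝ] E) → E → ℝ} (hG : Ell e lam L G)
    (hmax : ∀ x ∈ ball z r, U x + W x ≤ U z + W z)
    (hju : InterfaceJet e h G A R R (ball z r) U)
    (hjw : InterfaceJet e (fun b => -h (-b)) (fun T b => -G (-T) (-b)) (-B) R R (ball z r) W)
    (hUK : NormalLip e K (ball z r) U) (hWK : NormalLip e K' (ball z r) W)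
    (hsU : ∀ x, ∃ ξ : E, ⟪e, ξ⟫ = 0 ∧ ∀ y, ⟪e, y⟫ = ⟪e, x⟫ →
        U x + ⟪ξ, y - x⟫ - a * ‖y - x‖ ^ 2 ≤ U y)
    (hsW : ∀ x, ∃ ξ : E, ⟪e, ξ⟫ = 0 ∧ ∀ y, ⟪e, y⟫ = ⟪e, x⟫ →
        W x + ⟪ξ, y - x⟫ - a * ‖y - x‖ ^ 2 ≤ W y) : B ≤ A := by
  obtain ⟨c, hc0, hcU⟩ := hsU z
  obtain ⟨d, hd0, hdW⟩ := hsW z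
  have hmem : ∀ x ∈ ball (0 : E) r, z + x ∈ ball z r := by
    intro x hx
    rw [mem_ball, dist_eq_norm] at hx ⊢
    simpa using hx
  have hin : ∀ x, ⟪e, z + x⟫ = ⟪e, x⟫ := fun x => by rw [inner_add_right, hz, zero_add]
  have hsupU : ∀ x, ⟪e, x⟫ = 0 → U z + ⟪c, x⟫ - a * ‖x‖ ^ 2 ≤ U (z + x) := by
    intro x hx
    simpa using hcU (z + x) (by rw [hin, hx, hz])
  have hsupW : ∀ x, ⟪e, x⟫ = 0 → W z + ⟪d, x⟫ - a * ‖x‖ ^ 2 ≤ W (z + x) := by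
    intro x hx
    simpa using hdW (z + x) (by rw [hin, hx, hz])
  have hcd : d = -c := by
    rw [← sub_eq_zero, sub_neg_eq_add, ← norm_eq_zero]
    by_contra hne
    have hpos : 0 < ‖d + c‖ := lt_of_le_of_ne (norm_nonneg _) (Ne.symm hne)
    obtain ⟨s, hs, hs'⟩ : ∃ s > 0, s * ‖d + c‖ < r ∧ 2 * a * s < 1 := by
      refine ⟨min (r / (2 * ‖d + c‖)) (1 / (4 * a)), by positivity, ?_, ?_⟩
      · refine lt_of_le_of_lt (mul_le_mul_of_nonneg_right (min_le_left _ _) hpos.le) ?_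
        have : r / (2 * ‖d + c‖) * ‖d + c‖ = r / 2 := by field_simp
        linarith
      · have h1 : min (r / (2 * ‖d + c‖)) (1 / (4 * a)) ≤ 1 / (4 * a) := min_le_right _ _
        have h2 : 2 * a * (1 / (4 * a)) = 1 / 2 := by field_simp; norm_num
        nlinarith
    obtain ⟨hs1, hs2⟩ := hs'
    have ht : ⟪e, s • (d + c)⟫ = 0 := by
      rw [real_inner_smul_right, inner_add_right, hc0, hd0]; ring
    have hn : ‖s • (d + c)‖ = s * ‖d + c‖ := by
      rw [norm_smul, Real.norm_eq_abs, abs_of_pos hs]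
    have k1 := hsupU _ ht
    have k2 := hsupW _ ht
    have k3 := hmax _ (hmem (s • (d + c)) (by rw [mem_ball, dist_eq_norm, sub_zero, hn]; exact hs1))
    have k4 : ⟪d, s • (d + c)⟫ + ⟪c, s • (d + c)⟫ = s * ‖d + c‖ ^ 2 := by
      rw [← inner_add_left, real_inner_smul_right, real_inner_self_eq_norm_sq]
    rw [hn] at k1 k2
    have k5 : 0 < s * ‖d + c‖ ^ 2 := by positivity
    nlinarith
  subst hcd
  have hWt : ∀ b T x, Superjet (fun y => W (z + y) - W z + ⟪c, y⟫) x b T →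
      Superjet W (z + x) (b - c) T := by
    intro b T x hj
    have : Superjet (fun y => W (z + y) - W z - ⟪-c, y⟫) x b T := by
      simpa only [inner_neg_left, sub_neg_eq_add] using hj
    simpa only [sub_eq_add_neg] using this.of_translate
  have hneg : ∀ b : E, -(b - c) = c - b := fun b => by abel
  have hneg' : ∀ b : E, ‖b - c‖ = ‖c - b‖ := fun b => norm_sub_rev _ _
  refine interface_normalized (r := r) (C := a) (K := max K K') (R := R) he
    (U := fun y => U (z + y) - U z - ⟪c, y⟫) (W := fun y => W (z + y) - W z + ⟪c, y⟫)
    (by fun_prop) (by fun_prop) (by simp) (by simp) hr hlam hL hh hG c ?_ ?_ ?_ ?_ ?_ ?_ ?_ ?_ ?_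
    ?_ ?_ ?_
  · intro x hx
    have := hmax _ (hmem x hx)
    linarith
  · intro x hx ht
    have k1 := hmax _ (hmem x hx)
    have k2 := hsupW x ht
    rw [inner_neg_left] at k2
    rw [tang, ht]
    linarith
  · intro x hx ht
    have k1 := hmax _ (hmem x hx)
    have k2 := hsupU x ht
    rw [tang, ht]
    linarith
  · intro x τ ht _ _ _
    obtain ⟨ξ, hξ, hξ'⟩ := hsW (z + x)
    have k1 := hξ' (z + (x + τ)) (by rw [hin, hin, inner_add_right, ht, add_zero])
    have k2 := hξ' (z + (x - τ)) (by rw [hin, hin, inner_sub_right, ht, sub_zero])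
    have e1 : z + (x + τ) - (z + x) = τ := by abel
    have e2 : z + (x - τ) - (z + x) = -τ := by abel
    rw [e1] at k1
    rw [e2, inner_neg_right, norm_neg] at k2
    simp only [inner_add_right, inner_sub_right]
    linarith
  · intro x hx ht
    have k := hUK _ (hmem x hx) (by rw [hin]; exact ht)
    rw [hin, add_sub_assoc] at k
    rw [real_inner_comm] at hc0
    have k2 : K * -⟪e, x⟫ ≤ max K K' * -⟪e, x⟫ :=
      mul_le_mul_of_nonneg_right (le_max_left _ _) (by linarith)
    refine le_trans (le_of_eq ?_) (k.trans k2)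
    congr 1
    rw [inner_sub_right, real_inner_smul_right, hc0]
    ring
  · intro x hx ht
    have k := hWK _ (hmem x hx) (by rw [hin]; exact ht)
    rw [hin, add_sub_assoc] at k
    rw [real_inner_comm] at hc0
    have k2 : K' * -⟪e, x⟫ ≤ max K K' * -⟪e, x⟫ :=
      mul_le_mul_of_nonneg_right (le_max_right _ _) (by linarith)
    refine le_trans (le_of_eq ?_) (k.trans k2)
    congr 1
    rw [inner_sub_right, real_inner_smul_right, hc0]
    ring
  · intro x hx ht b T hj
    exact (hju _ (hmem x hx) _ _ hj.of_translate).1 (by rw [hin]; exact ht)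
  · intro x hx ht b T hj
    have k := (hjw _ (hmem x hx) _ _ (hWt _ _ _ hj)).1 (by rw [hin]; exact ht)
    simp only [hneg, hneg'] at k
    exact ⟨k.1, by linarith [k.2]⟩
  · intro b T hj hb
    exact (hju _ (hmem 0 (mem_ball_self hr)) _ _ hj.of_translate).2.1
      (by rw [hin, inner_zero_right]) hb
  · intro b T hj hb
    have k := (hjw _ (hmem 0 (mem_ball_self hr)) _ _ (hWt _ _ _ hj)).2.1
      (by rw [hin, inner_zero_right]) (by rw [hneg']; exact hb)
    simp only [hneg] at k
    linarith
  · intro x hx ht b T hj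
    exact (hju _ (hmem x hx) _ _ hj.of_translate).2.2 (by rw [hin]; exact ht)
  · intro x hx ht b T hj
    have k := (hjw _ (hmem x hx) _ _ (hWt _ _ _ hj)).2.2 (by rw [hin]; exact ht)
    simp only [hneg] at k
    linarith

lemma InterfaceJet.mono {h : E → ℝ} {G : (E →L[ℝ] E) → E → ℝ} {A R R' : ℝ} {S S' : Set E}
    {u : E → ℝ} (hu : InterfaceJet e h G A R R' S u) (hS : S' ⊆ S) :
    InterfaceJet e h G A R R' S' u := fun x hx => hu x (hS hx)

lemma NormalLip.mono {K : ℝ} {S S' : Set E} {u : E → ℝ} (hu : NormalLip e K S u) (hS : S' ⊆ S) :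
    NormalLip e K S' u := fun x hx => hu x (hS hx)

/-- Comparison at a strict maximum on the interface. -/
lemma interface_strict [FiniteDimensional ℝ E] (he : ‖e‖ = 1) {u w : E → ℝ}
    (hu : Continuous u) (hw : Continuous w) {z : E} (hz : ⟪e, z⟫ = 0)
    {ρ κ K K' R A B lam L : ℝ} (hρ : 0 < ρ) (hκ : 0 < κ) (hlam : 0 < lam) (hL : 0 ≤ L)
    {h : E → ℝ} (hh : Continuous h) {G : (E →L[ℝ] E) → E → ℝ} (hG : Ell e lam L G)
    (hmax : ∀ x ∈ closedBall z ρ, u x + w x ≤ u z + w z - κ * ‖x - z‖ ^ 2)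
    (hju : InterfaceJet e h G A R R (ball z ρ) u)
    (hjw : InterfaceJet e (fun b => -h (-b)) (fun T b => -G (-T) (-b)) (-B) R R (ball z ρ) w)
    (hUK : NormalLip e K (ball z ρ) u) (hWK : NormalLip e K' (ball z ρ) w) : B ≤ A := by
  obtain ⟨δ, hδ, _, hδ'⟩ := strict_doubling (isCompact_closedBall z ρ) hw.continuousOn hκ
    (by positivity : 0 < ρ / 8) hmax
  obtain ⟨σ, hσ, hσδ, hσρ⟩ : ∃ σ > 0, 2 * σ ≤ δ ∧ σ ≤ ρ / 16 :=
    ⟨min (δ / 2) (ρ / 16), by positivity, by linarith [min_le_left (δ / 2) (ρ / 16)],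
      min_le_right _ _⟩
  have hcpt := isCompact_closedBall z (2 * ρ)
  obtain ⟨N1, hN1⟩ := hcpt.exists_bound_of_continuousOn hu.continuousOn
  obtain ⟨N2, hN2⟩ := hcpt.exists_bound_of_continuousOn hw.continuousOn
  obtain ⟨a, ha, ha1, ha2⟩ : ∃ a > 0, 2 * N1 ≤ a * σ ^ 2 ∧ 2 * N2 ≤ a * σ ^ 2 := by
    refine ⟨(2 * (|N1| + |N2|) + 1) / σ ^ 2, by positivity, ?_, ?_⟩ <;>
    · rw [div_mul_cancel₀ _ (by positivity)]
      linarith [le_abs_self N1, le_abs_self N2, abs_nonneg N1, abs_nonneg N2]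
  obtain ⟨U, p, hUc, huU, hUp, hep, hpx, hUj, hUl, hUs⟩ := exists_tangential_sup he hu hz hρ hσ
    (by linarith) ha hN1 ha1
  obtain ⟨W, q, hWc, hwW, hWq, heq, hqx, hWj, hWl, hWs⟩ := exists_tangential_sup he hw hz hρ hσ
    (by linarith) ha hN2 ha2
  have hjU : InterfaceJet e h G A R R (ball z (ρ / 2)) U := by
    intro x hx b T hj
    have h1 := hpx x hx
    have := hju (p x) (by
      rw [mem_ball, dist_eq_norm] at hx ⊢
      have := norm_add_le (p x - x) (x - z)
      rw [sub_add_sub_cancel] at this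
      linarith) b T (hUj x hx b T hj)
    rwa [hep] at this
  have hjW : InterfaceJet e (fun b => -h (-b)) (fun T b => -G (-T) (-b)) (-B) R R
      (ball z (ρ / 2)) W := by
    intro x hx b T hj
    have h1 := hqx x hx
    have := hjw (q x) (by
      rw [mem_ball, dist_eq_norm] at hx ⊢
      have := norm_add_le (q x - x) (x - z)
      rw [sub_add_sub_cancel] at this
      linarith) b T (hWj x hx b T hj)
    rwa [heq] at this
  obtain ⟨y, hy, hymax⟩ := (isCompact_closedBall z (ρ / 4)).exists_isMaxOn
    ⟨z, mem_closedBall_self (by positivity)⟩ (hUc.add hWc).continuousOn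
  have hy2 : y ∈ ball z (ρ / 2) := closedBall_subset_ball (by linarith) hy
  have hyz : ‖y - z‖ ≤ ρ / 4 := by rwa [mem_closedBall, dist_eq_norm] at hy
  have hylt : ‖y - z‖ < ρ / 4 := by
    have k1 := hpx y hy2
    have k2 := hqx y hy2
    have hclose : ∀ s, ‖s - y‖ ≤ σ → s ∈ closedBall z ρ := by
      intro s hs
      rw [mem_closedBall, dist_eq_norm]
      have := norm_add_le (s - y) (y - z)
      rw [sub_add_sub_cancel] at this
      linarith
    have k3 : ‖p y - q y‖ ≤ δ := by
      have e1 : p y - q y = (p y - y) - (q y - y) := by abel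
      rw [e1]
      exact (norm_sub_le _ _).trans (by linarith)
    have hzb : z ∈ ball z (ρ / 2) := mem_ball_self (by positivity)
    have k4 : U z + W z ≤ U y + W y := hymax (mem_closedBall_self (by positivity))
    have k5 := hδ' (p y) (hclose _ k1) (q y) (hclose _ k2) k3
      (by linarith [huU z hzb, hwW z hzb, hUp y, hWq y])
    have k6 := norm_sub_le (p y - z) (p y - y)
    have e1 : p y - z - (p y - y) = y - z := by abel
    rw [e1] at k6
    linarith
  obtain ⟨r, hr, hrsub⟩ : ∃ r > 0, ball y r ⊆ ball z (ρ / 4) := by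
    refine ⟨ρ / 4 - ‖y - z‖, by linarith, ball_subset_ball' ?_⟩
    rw [dist_eq_norm]; linarith
  have hrsub2 : ball y r ⊆ ball z (ρ / 2) := hrsub.trans (ball_subset_ball (by linarith))
  have hmaxy : ∀ x ∈ ball y r, U x + W x ≤ U y + W y := fun x hx =>
    hymax (ball_subset_closedBall (hrsub hx))
  have hinn : ∀ x s, x ∈ ball y s → |⟪e, x⟫ - ⟪e, y⟫| < s := by
    intro x s hx
    rw [mem_ball, dist_eq_norm] at hx
    rw [← inner_sub_right]
    exact (abs_inner_unit_le he _).trans_lt hx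
  rcases lt_trichotomy ⟪e, y⟫ 0 with ht | ht | ht
  · have hs : 0 < min (r / 2) (-⟪e, y⟫) := lt_min (by positivity) (by linarith)
    have hss : ∀ x ∈ ball y (min (r / 2) (-⟪e, y⟫)), x ∈ ball z (ρ / 2) ∧ ⟪e, x⟫ < 0 := by
      intro x hx
      refine ⟨hrsub2 (ball_subset_ball ((min_le_left _ _).trans (by linarith)) hx), ?_⟩
      have := hinn x _ hx
      rw [abs_lt] at this
      linarith [min_le_right (r / 2) (-⟪e, y⟫), this.2]
    refine firstOrder_interior (z := y) (R := R) hUc hWc hs hh ?_ ?_ ?_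
    · intro x hx
      exact hmaxy x (closedBall_subset_ball ((min_le_left _ _).trans_lt (by linarith)) hx)
    · intro x hx b T hj
      exact (hjU x (hss x hx).1 b T hj).1 (hss x hx).2
    · intro x hx b T hj
      have := ((hjW x (hss x hx).1 b T hj).1 (hss x hx).2).2
      linarith
  · exact interface_semiconvex he hUc hWc ht hr hlam hL ha hh hG hmaxy (hjU.mono hrsub2)
      (hjW.mono hrsub2) ((hUl K hUK).mono hrsub2) ((hWl K' hWK).mono hrsub2) hUs hWs
  · have hs : 0 < min (r / 2) ⟪e, y⟫ := lt_min (by positivity) ht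
    have hss : ∀ x ∈ ball y (min (r / 2) ⟪e, y⟫), x ∈ ball z (ρ / 2) ∧ 0 < ⟪e, x⟫ := by
      intro x hx
      refine ⟨hrsub2 (ball_subset_ball ((min_le_left _ _).trans (by linarith)) hx), ?_⟩
      have := hinn x _ hx
      rw [abs_lt] at this
      linarith [min_le_right (r / 2) ⟪e, y⟫, this.1]
    refine secondOrder_interior (z := y) hUc hWc hs hL hG ?_ ?_ ?_
    · intro x hx
      exact hmaxy x (closedBall_subset_ball ((min_le_left _ _).trans_lt (by linarith)) hx)
    · intro x hx b T hj
      exact (hjU x (hss x hx).1 b T hj).2.2 (hss x hx).2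
    · intro x hx b T hj
      have := (hjW x (hss x hx).1 b T hj).2.2 (hss x hx).2
      linarith

/-- Comparison at a maximum on the interface. -/
lemma interface_comparison [FiniteDimensional ℝ E] (he : ‖e‖ = 1) {u w : E → ℝ}
    (hu : Continuous u) (hw : Continuous w) {z : E} (hz : ⟪e, z⟫ = 0)
    {ρ K K' R A B lam L : ℝ} (hρ : 0 < ρ) (hlam : 0 < lam) (hL : 0 ≤ L)
    {h : E → ℝ} (hh : Continuous h) {G : (E →L[ℝ] E) → E → ℝ} (hG : Ell e lam L G)
    (hmax : ∀ x ∈ closedBall z ρ, u x + w x ≤ u z + w z)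
    (hju : InterfaceJet e h G A R (R + 2) (ball z ρ) u)
    (hjw : InterfaceJet e (fun b => -h (-b)) (fun T b => -G (-T) (-b)) (-B) R (R + 2)
      (ball z ρ) w)
    (hUK : NormalLip e K (ball z ρ) u) (hWK : NormalLip e K' (ball z ρ) w) : B ≤ A := by
  refine le_of_forall_pos_le_add fun ε hε => ?_
  have huc := (isCompact_closedBall (0 : E) (R + 2)).uniformContinuousOn_of_continuous
    hh.continuousOn
  rw [Metric.uniformContinuousOn_iff] at huc
  obtain ⟨d, hd, hd'⟩ := huc ε hε
  obtain ⟨κ, hκ, hκd, hκ1, hκε⟩ : ∃ κ > 0, 2 * κ * ρ < d ∧ 2 * κ * ρ ≤ 1 ∧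
      L * (2 * κ + 2 * κ * ρ) ≤ ε := by
    refine ⟨min (d / (4 * ρ)) (min (1 / (2 * ρ)) (ε / (2 * (L + 1) * (1 + ρ)))), by positivity,
      ?_, ?_, ?_⟩
    · have h1 : min (d / (4 * ρ)) (min (1 / (2 * ρ)) (ε / (2 * (L + 1) * (1 + ρ))))
          ≤ d / (4 * ρ) := min_le_left _ _
      rw [le_div_iff₀ (by positivity)] at h1
      nlinarith
    · have h1 : min (d / (4 * ρ)) (min (1 / (2 * ρ)) (ε / (2 * (L + 1) * (1 + ρ))))
          ≤ 1 / (2 * ρ) := (min_le_right _ _).trans (min_le_left _ _)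
      rw [le_div_iff₀ (by positivity)] at h1
      nlinarith
    · obtain ⟨m, hm⟩ : ∃ m, m = min (d / (4 * ρ)) (min (1 / (2 * ρ))
        (ε / (2 * (L + 1) * (1 + ρ)))) := ⟨_, rfl⟩
      have h0 : 0 < m := by rw [hm]; positivity
      have h1 : m ≤ ε / (2 * (L + 1) * (1 + ρ)) := by
        rw [hm]; exact (min_le_right _ _).trans (min_le_right _ _)
      rw [← hm]
      rw [le_div_iff₀ (by positivity)] at h1
      have : 0 < m * (1 + ρ) := by positivity
      nlinarith
  have hjt : ∀ x b T, Superjet (fun y => u y - κ * ‖y - z‖ ^ 2) x b T →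
      Superjet u x (b + (2 * κ) • (x - z)) (T + quadOp e (2 * κ) 0) := by
    intro x b T hj
    have h1 : Superjet (fun y => u y -
        (⟪(0 : E), y⟫ + 2 * κ / 2 * ‖y - z‖ ^ 2 - 0 / 2 * ⟪e, y - z⟫ ^ 2)) x b T := by
      have e1 : (fun y => u y -
        (⟪(0 : E), y⟫ + 2 * κ / 2 * ‖y - z‖ ^ 2 - 0 / 2 * ⟪e, y - z⟫ ^ 2)) =
          fun y => u y - κ * ‖y - z‖ ^ 2 := by
        funext y; rw [inner_zero_left]; ring
      rw [e1]; exact hj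
    simpa using h1.add_quad e 0 z (2 * κ) 0
  refine interface_strict (R := R + 1) (κ := κ) (K := K + κ * ρ) (K' := K') (w := w)
    (u := fun y => u y - κ * ‖y - z‖ ^ 2) he (by fun_prop) hw hz hρ hκ hlam hL hh hG ?_ ?_ ?_ ?_ hWK
  · intro x hx
    have := hmax x hx
    simp only [sub_self, norm_zero]
    linarith
  · intro x hx b T hj
    obtain ⟨k1, k2, k3⟩ := hju x hx _ _ (hjt x b T hj)
    have hq : ‖(2 * κ) • (x - z)‖ ≤ 2 * κ * ρ := by
      rw [norm_smul, Real.norm_eq_abs, abs_of_pos (by positivity)]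
      rw [mem_ball, dist_eq_norm] at hx
      exact mul_le_mul_of_nonneg_left hx.le (by positivity)
    have hb1 : ‖b‖ ≤ ‖b + (2 * κ) • (x - z)‖ + ‖(2 * κ) • (x - z)‖ := by
      simpa using norm_sub_le (b + (2 * κ) • (x - z)) ((2 * κ) • (x - z))
    have hb2 := norm_add_le b ((2 * κ) • (x - z))
    have hcl : ‖b‖ ≤ R + 2 → ‖b + (2 * κ) • (x - z)‖ ≤ R + 2 →
        h (b + (2 * κ) • (x - z)) ≤ A → h b ≤ A + ε := by
      intro m1 m2 m3
      have := hd' b (by simpa using m1) (b + (2 * κ) • (x - z)) (by simpa using m2)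
        (by rw [dist_eq_norm]; simpa using hq.trans_lt hκd)
      rw [Real.dist_eq, abs_lt] at this
      linarith [this.2]
    refine ⟨fun ht => ?_, fun ht hb => ?_, fun ht => ?_⟩
    · obtain ⟨m1, m2⟩ := k1 ht
      exact ⟨by linarith, hcl (by linarith) (by linarith) m2⟩
    · exact hcl (by linarith) (by linarith) (k2 ht (by linarith))
    · have m1 := k3 ht
      have m2 := hG T b ((2 * κ) • (x - z)) (2 * κ) 0 (by positivity) le_rfl
      have m3 : L * (2 * κ + ‖(2 * κ) • (x - z)‖) ≤ L * (2 * κ + 2 * κ * ρ) := by gcongr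
      linarith
  · intro x hx b T hj
    obtain ⟨k1, k2, k3⟩ := hjw x hx b T hj
    exact ⟨fun ht => ⟨(k1 ht).1.trans (by linarith), (k1 ht).2⟩,
      fun ht hb => k2 ht (hb.trans (by linarith)), k3⟩
  · intro x hx ht
    have k := hUK x hx ht
    have e1 : ‖x - z‖ ^ 2 = ‖x - ⟪e, x⟫ • e - z‖ ^ 2 + ⟪e, x⟫ ^ 2 := by
      have := sq_norm_sub_inner_smul he (x - z)
      rw [tang, inner_sub_right, hz, sub_zero] at this
      have e2 : x - ⟪e, x⟫ • e - z = x - z - ⟪e, x⟫ • e := by abel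
      rw [e2, this]; ring
    have e3 : |⟪e, x⟫| ≤ ρ := by
      have := abs_inner_unit_le he (x - z)
      rw [inner_sub_right, hz, sub_zero] at this
      rw [mem_ball, dist_eq_norm] at hx
      linarith
    have e4 : u x - κ * ‖x - z‖ ^ 2 - (u (x - ⟪e, x⟫ • e) - κ * ‖x - ⟪e, x⟫ • e - z‖ ^ 2) =
        (u x - u (x - ⟪e, x⟫ • e)) - κ * ⟪e, x⟫ ^ 2 := by rw [e1]; ring
    have e5 : κ * ⟪e, x⟫ ^ 2 ≤ κ * ρ * -⟪e, x⟫ := by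
      rw [abs_of_nonpos ht] at e3
      have : ⟪e, x⟫ ^ 2 ≤ ρ * -⟪e, x⟫ := by nlinarith
      nlinarith
    have e6 : 0 ≤ κ * ⟪e, x⟫ ^ 2 := by positivity
    simp only [e4]
    rw [abs_le] at k ⊢
    constructor <;> linarith [k.1, k.2]

end InterfacePoint

section Operators

open scoped Matrix

/-- The matrix of the bilinear form of an operator in the standard basis. -/
def formMatrix {n : ℕ} (T : Euc n →L[ℝ] Euc n) : Matrix (Fin n) (Fin n) ℝ :=
  Matrix.of fun i j =>
    ⟪T (EuclideanSpace.single i (1 : ℝ)), EuclideanSpace.single j (1 : ℝ)⟫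

/-- The quadratic polynomial with value `m`, gradient `b` and Hessian `T` at `x`. -/
def quadPoly {n : ℕ} (m : ℝ) (x b : Euc n) (T : Euc n →L[ℝ] Euc n) (y : Euc n) : ℝ :=
  m + ⟪b, y - x⟫ + ⟪T (y - x), y - x⟫ / 2

lemma quadPoly_self {n : ℕ} (m : ℝ) (x b : Euc n) (T : Euc n →L[ℝ] Euc n) :
    quadPoly m x b T x = m := by
  simp [quadPoly]

lemma hasFDerivAt_quadPoly {n : ℕ} (m : ℝ) (x b : Euc n) {T : Euc n →L[ℝ] Euc n}
    (hT : ∀ y z, ⟪T y, z⟫ = ⟪y, T z⟫) (y : Euc n) :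
    HasFDerivAt (quadPoly m x b T) (innerSL ℝ (b + T (y - x))) y := by
  have h1 : HasFDerivAt (fun y => y - x) (ContinuousLinearMap.id ℝ (Euc n)) y :=
    (hasFDerivAt_id y).sub_const x
  have h2 := T.hasFDerivAt.comp y h1
  have h3 := (((hasFDerivAt_const b y).inner ℝ h1).const_add m).add
    ((h2.inner ℝ h1).const_mul (1 / 2 : ℝ))
  have e1 : quadPoly m x b T = (fun y => m + ⟪b, y - x⟫) +
      fun y => 1 / 2 * ⟪(T ∘ fun y => y - x) y, y - x⟫ := by
    funext y
    simp only [quadPoly, Pi.add_apply, Function.comp_apply]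
    ring
  rw [e1]
  refine h3.congr_fderiv ?_
  ext k
  have e2 : ⟪T k, y - x⟫ = ⟪T (y - x), k⟫ := by rw [hT, real_inner_comm]
  simp only [add_apply, smul_apply, ContinuousLinearMap.comp_apply, ContinuousLinearMap.prod_apply,
    ContinuousLinearMap.id_apply, fderivInnerCLM_apply, Function.comp_apply, zero_apply,
    inner_zero_left, innerSL_apply_apply, inner_add_left, e2, smul_eq_mul]
  ring

lemma contDiff_quadPoly {n : ℕ} (m : ℝ) (x b : Euc n) (T : Euc n →L[ℝ] Euc n) :
    ContDiff ℝ 2 (quadPoly m x b T) := by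
  have h1 : ContDiff ℝ 2 fun y : Euc n => y - x := by fun_prop
  exact (contDiff_const.add (contDiff_const.inner ℝ h1)).add
    (((T.contDiff.comp h1).inner ℝ h1).div_const 2)

lemma gradient_quadPoly {n : ℕ} (m : ℝ) (x b : Euc n) {T : Euc n →L[ℝ] Euc n}
    (hT : ∀ y z, ⟪T y, z⟫ = ⟪y, T z⟫) : gradient (quadPoly m x b T) x = b := by
  have h := hasFDerivAt_quadPoly m x b hT x
  refine HasGradientAt.gradient ?_
  rw [hasGradientAt_iff_hasFDerivAt]
  refine h.congr_fderiv ?_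
  ext k
  simp

lemma hessianMatrix_quadPoly {n : ℕ} (m : ℝ) (x b : Euc n) {T : Euc n →L[ℝ] Euc n}
    (hT : ∀ y z, ⟪T y, z⟫ = ⟪y, T z⟫) :
    hessianMatrix (quadPoly m x b T) x = formMatrix T := by
  have h1 : fderiv ℝ (quadPoly m x b T) = fun y => innerSL ℝ (b + T (y - x)) := by
    funext y
    exact (hasFDerivAt_quadPoly m x b hT y).fderiv
  have h2 : HasFDerivAt (fun y => innerSL ℝ (b + T (y - x))) ((innerSL ℝ).comp T) x := by
    have k1 : HasFDerivAt (fun y => y - x) (ContinuousLinearMap.id ℝ (Euc n)) x :=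
      (hasFDerivAt_id x).sub_const x
    have k2 := (T.hasFDerivAt.comp x k1).const_add b
    exact ((innerSL ℝ).hasFDerivAt.comp x k2)
  ext i j
  simp only [hessianMatrix, formMatrix, Matrix.of_apply]
  rw [iteratedFDeriv_two_apply, h1, h2.fderiv]
  simp

lemma exists_subTest {n : ℕ} {Ω : Set (Euc n)} (hΩ : IsOpen Ω) {u : Euc n → ℝ} {x b : Euc n}
    {T : Euc n →L[ℝ] Euc n} (hx : x ∈ Ω) (hj : Superjet u x b T) :
    ∃ r, SubTest Ω u x (quadPoly (u x) x b T) r := by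
  obtain ⟨r1, hr1, h1⟩ := Metric.eventually_nhds_iff.1 hj.2
  obtain ⟨r2, hr2, h2⟩ := Metric.isOpen_iff.1 hΩ x hx
  refine ⟨min r1 r2, lt_min hr1 hr2, (ball_subset_ball (min_le_right _ _)).trans h2,
    (contDiff_quadPoly _ _ _ _).contDiffOn, fun y hy => ?_, (quadPoly_self _ _ _ _).symm⟩
  exact h1 (lt_of_lt_of_le (mem_ball.1 hy) (min_le_left _ _))

lemma exists_supTest {n : ℕ} {Ω : Set (Euc n)} (hΩ : IsOpen Ω) {v : Euc n → ℝ} {x b : Euc n}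
    {T : Euc n →L[ℝ] Euc n} (hx : x ∈ Ω) (hj : Superjet (fun y => -v y) x b T) :
    ∃ r, SupTest Ω v x (quadPoly (v x) x (-b) (-T)) r := by
  obtain ⟨r1, hr1, h1⟩ := Metric.eventually_nhds_iff.1 hj.2
  obtain ⟨r2, hr2, h2⟩ := Metric.isOpen_iff.1 hΩ x hx
  refine ⟨min r1 r2, lt_min hr1 hr2, (ball_subset_ball (min_le_right _ _)).trans h2,
    (contDiff_quadPoly _ _ _ _).contDiffOn, fun y hy => ?_, (quadPoly_self _ _ _ _).symm⟩
  have := h1 (lt_of_lt_of_le (mem_ball.1 hy) (min_le_left _ _))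
  simp only [quadPoly, inner_neg_left, neg_apply]
  linarith

/-- Superjets of Lipschitz functions have bounded gradient part. -/
lemma norm_le_of_superjet_of_lipschitz {E : Type*} [NormedAddCommGroup E] [InnerProductSpace ℝ E]
    {u : E → ℝ} {x b : E} {T : E →L[ℝ] E} {K : ℝ} (hK0 : 0 ≤ K)
    (hj : Superjet u x b T)
    (hK : ∀ᶠ y in 𝓝 x, |u y - u x| ≤ K * ‖y - x‖) : ‖b‖ ≤ K := by
  by_contra! hlt
  have hb : 0 < ‖b‖ := hK0.trans_lt hlt
  have hpos : 0 < (‖b‖ - K) * ‖b‖ := mul_pos (by linarith) hb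
  have ht : Tendsto (fun s : ℝ => x - s • b) (𝓝[>] 0) (𝓝 x) := by
    have : Continuous fun s : ℝ => x - s • b := by fun_prop
    have h := this.tendsto 0
    rw [zero_smul, sub_zero] at h
    exact h.mono_left nhdsWithin_le_nhds
  have hsm : ∀ᶠ s : ℝ in 𝓝[>] 0, s * (⟪T b, b⟫ / 2) < (‖b‖ - K) * ‖b‖ := by
    have hc : Continuous fun s : ℝ => s * (⟪T b, b⟫ / 2) := by fun_prop
    have h := hc.tendsto 0
    rw [zero_mul] at h
    exact (h.mono_left nhdsWithin_le_nhds).eventually_lt_const hpos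
  obtain ⟨s, ⟨hs1, hs2, hs3⟩, hs0⟩ :=
    (((ht.eventually hj.2).and ((ht.eventually hK).and hsm)).and self_mem_nhdsWithin).exists
  have e1 : x - s • b - x = -(s • b) := by abel
  rw [e1] at hs1 hs2
  rw [norm_neg, norm_smul, Real.norm_eq_abs, abs_of_pos hs0, abs_le] at hs2
  simp only [inner_neg_right, inner_neg_left, map_neg, map_smul, real_inner_smul_left,
    real_inner_smul_right, real_inner_self_eq_norm_sq] at hs1
  have h1 := mul_lt_mul_of_pos_left hs3 hs0
  nlinarith [hs2.1]

end Operators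

section Ellipticity

lemma smul_one_mem_pucciSet (m : ℕ) {l L : ℝ} (h : l ≤ L) :
    l • (1 : Matrix (Fin m) (Fin m) ℝ) ∈ pucciSet m l L := by
  refine ⟨by simpa using Matrix.PosSemidef.zero, ?_⟩
  rw [← sub_smul]
  exact Matrix.PosSemidef.one.smul (sub_nonneg.2 h)

lemma diag_of_mem_pucciSet {m : ℕ} {l L : ℝ} {A : Matrix (Fin m) (Fin m) ℝ}
    (hA : A ∈ pucciSet m l L) (i : Fin m) : l ≤ A i i ∧ A i i ≤ L := by
  have h1 := hA.1.diag_nonneg (i := i)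
  have h2 := hA.2.diag_nonneg (i := i)
  simp at h1 h2
  exact ⟨h1, h2⟩

lemma pucciMinus_zero {m : ℕ} {l L : ℝ} (h : l ≤ L) :
    pucciMinus l L (0 : Matrix (Fin m) (Fin m) ℝ) = 0 := by
  have hne : (pucciSet m l L).Nonempty := ⟨_, smul_one_mem_pucciSet m h⟩
  simp [pucciMinus, hne.image_const]

lemma pucciPlus_zero {m : ℕ} {l L : ℝ} (h : l ≤ L) :
    pucciPlus l L (0 : Matrix (Fin m) (Fin m) ℝ) = 0 := by
  have hne : (pucciSet m l L).Nonempty := ⟨_, smul_one_mem_pucciSet m h⟩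
  simp [pucciPlus, hne.image_const]

lemma UnifEllipticF.mono {m : ℕ} {l L : ℝ} {F : Matrix (Fin m) (Fin m) ℝ → Euc m → ℝ → ℝ}
    (hF : UnifEllipticF l L F) (h : l ≤ L) (M : Matrix (Fin m) (Fin m) ℝ) (p : Euc m) {z z' : ℝ}
    (hz : z ≤ z') : F M p z ≤ F M p z' := by
  have := (hF M M p p z z').1
  rw [sub_self, sub_self, pucciMinus_zero h, norm_zero, max_eq_right (by linarith)] at this
  linarith

lemma UnifEllipticF.le_add {m : ℕ} {l L : ℝ} {F : Matrix (Fin m) (Fin m) ℝ → Euc m → ℝ → ℝ}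
    (hF : UnifEllipticF l L F) (h : l ≤ L) (M : Matrix (Fin m) (Fin m) ℝ) (p : Euc m) (z z' : ℝ) :
    F M p z' ≤ F M p z + L * max (z' - z) 0 := by
  have := (hF M M p p z z').2
  rw [sub_self, sub_self, pucciPlus_zero h, norm_zero] at this
  linarith

lemma formMatrix_quadOp {m : ℕ} (T : Euc m →L[ℝ] Euc m) (k : Fin m) (α β : ℝ) :
    formMatrix (T + quadOp (EuclideanSpace.single k 1) α β) - formMatrix T =
      α • (1 : Matrix (Fin m) (Fin m) ℝ) - β • Matrix.single k k (1 : ℝ) := by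
  ext i j
  simp only [formMatrix, Matrix.of_apply, Matrix.sub_apply, add_apply, inner_add_left,
    quadOp_apply, inner_sub_left, real_inner_smul_left, Matrix.smul_apply, smul_eq_mul,
    EuclideanSpace.inner_single_left, Matrix.one_apply, Matrix.single_apply]
  by_cases h1 : k = i <;> by_cases h2 : k = j <;> by_cases h3 : i = j <;>
    simp_all [eq_comm]

lemma le_pucciMinus {m : ℕ} {l L : ℝ} (h : l ≤ L) (k : Fin m) {α β : ℝ} (hα : 0 ≤ α)
    (hβ : 0 ≤ β) :
    l * β - L * m * α ≤
      pucciMinus l L (α • (1 : Matrix (Fin m) (Fin m) ℝ) - β • Matrix.single k k (1 : ℝ)) := by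
  have hne : (pucciSet m l L).Nonempty := ⟨_, smul_one_mem_pucciSet m h⟩
  refine le_csInf (hne.image _) ?_
  rintro _ ⟨A, hA, rfl⟩
  have h1 : (A * (α • (1 : Matrix (Fin m) (Fin m) ℝ) - β • Matrix.single k k (1 : ℝ))).trace =
      α * A.trace - β * A k k := by
    simp [mul_sub, Matrix.trace_sub, Matrix.trace_smul, Matrix.trace_mul_single, mul_comm]
  have h2 : A.trace ≤ m * L := by
    have : A.trace ≤ ∑ _i : Fin m, L :=
      Finset.sum_le_sum fun i _ => (diag_of_mem_pucciSet hA i).2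
    simpa using this
  have h3 := mul_le_mul_of_nonneg_left h2 hα
  have h4 := mul_le_mul_of_nonneg_left (diag_of_mem_pucciSet hA k).1 hβ
  simp only [h1]
  linarith

lemma UnifEllipticF.ell {m : ℕ} {l L : ℝ} {F : Matrix (Fin m) (Fin m) ℝ → Euc m → ℝ → ℝ}
    (hF : UnifEllipticF l L F) (hl : 0 < l) (h : l ≤ L) (k : Fin m) (z c : ℝ) :
    Ell (EuclideanSpace.single k (1 : ℝ)) l (L * m) (fun T b => F (formMatrix T) b z + c) := by
  intro T p q α β hα hβ
  have h1 := (hF (formMatrix T) (formMatrix (T + quadOp (EuclideanSpace.single k 1) α β)) p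
    (p + q) z z).1
  rw [formMatrix_quadOp, add_sub_cancel_left, sub_self, neg_zero, max_self] at h1
  have h2 := le_pucciMinus h k hα hβ
  have h3 : (1 : ℝ) ≤ m := by
    have : 0 < m := Fin.pos k
    exact_mod_cast this
  have h4 : L * ‖q‖ ≤ L * m * ‖q‖ := by
    have : 0 ≤ L * ‖q‖ := mul_nonneg (hl.le.trans h) (norm_nonneg q)
    nlinarith
  simp only
  linarith

end Ellipticity

section Freezing

variable {m : ℕ} {S : Set (Euc m)} {H : Euc m → ℝ → Euc m → ℝ}

lemma LocallyLipschitzOp1.continuousOn (hH : LocallyLipschitzOp1 S H) :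
    ContinuousOn (fun q : Euc m × ℝ × Euc m => H q.1 q.2.1 q.2.2) (univ ×ˢ univ ×ˢ S) := by
  intro q hq
  obtain ⟨K, t, ht, hK⟩ := hH q hq.2.2
  exact (hK.continuousOn q (mem_of_mem_nhdsWithin hq ht)).mono_of_mem_nhdsWithin ht

lemma LocallyLipschitzOp1.continuous_left (hH : LocallyLipschitzOp1 S H) {x : Euc m} (hx : x ∈ S)
    (z : ℝ) : Continuous fun b => H b z x := by
  have h1 : Continuous fun b : Euc m => (b, z, x) := by fun_prop
  exact hH.continuousOn.comp_continuous h1 fun b => ⟨mem_univ _, mem_univ _, hx⟩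

lemma LocallyLipschitzOp1.eventually_close (hH : LocallyLipschitzOp1 S H) {x : Euc m} (hx : x ∈ S)
    {g : Euc m → ℝ} (hg : Continuous g) (R : ℝ) {ε : ℝ} (hε : 0 < ε) :
    ∀ᶠ y in 𝓝 x, ∀ b ∈ closedBall (0 : Euc m) R, y ∈ S → |H b (g y) y - H b (g x) x| < ε := by
  refine (isCompact_closedBall (0 : Euc m) R).eventually_forall_of_forall_eventually ?_
  intro b _
  have h1 := hH.continuousOn (b, g x, x) ⟨mem_univ _, mem_univ _, hx⟩
  have h2 := (Metric.continuousWithinAt_iff'.1 h1) (ε / 2) (by positivity)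
  rw [eventually_nhdsWithin_iff] at h2
  have hc1 : Continuous fun q : Euc m × Euc m => (q.2, g q.1, q.1) := by fun_prop
  have hc2 : Continuous fun q : Euc m × Euc m => (q.2, g x, x) := by fun_prop
  have t1 := (hc1.tendsto (x, b)).eventually h2
  have t2 := (hc2.tendsto (x, b)).eventually h2
  filter_upwards [t1, t2] with q k1 k2 hq
  have k1 := k1 ⟨mem_univ _, mem_univ _, hq⟩
  have k2 := k2 ⟨mem_univ _, mem_univ _, hx⟩
  rw [Real.dist_eq, abs_lt] at k1 k2
  rw [abs_lt]
  constructor <;> linarith [k1.1, k1.2, k2.1, k2.2]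

lemma eventually_close_of_continuousOn {f : ℝ → Euc m → ℝ}
    (hf : ContinuousOn (fun q : ℝ × Euc m => f q.1 q.2) (univ ×ˢ S)) {x : Euc m} (hx : x ∈ S)
    {g : Euc m → ℝ} (hg : Continuous g) {ε : ℝ} (hε : 0 < ε) :
    ∀ᶠ y in 𝓝 x, y ∈ S → |f (g y) y - f (g x) x| < ε := by
  have h2 := (Metric.continuousWithinAt_iff'.1 (hf (g x, x) ⟨mem_univ _, hx⟩)) ε hε
  rw [eventually_nhdsWithin_iff] at h2
  have hc1 : Continuous fun y : Euc m => (g y, y) := by fun_prop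
  filter_upwards [(hc1.tendsto x).eventually h2] with y k1 hy
  simpa [Real.dist_eq] using k1 ⟨mem_univ _, hy⟩

lemma exists_continuous_extension {S : Set (Euc m)} (hS : IsClosed S) {u : Euc m → ℝ}
    (hu : ContinuousOn u S) : ∃ g : Euc m → ℝ, Continuous g ∧ EqOn g u S := by
  obtain ⟨g, hg⟩ := ContinuousMap.exists_restrict_eq hS ⟨S.domRestrict u, hu.domRestrict⟩
  refine ⟨g, g.continuous, fun x hx => ?_⟩
  exact congrArg (fun k : C(S, ℝ) => k ⟨x, hx⟩) hg

end Freezing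

section LipschitzBelow

variable {n : ℕ}

lemma inner_single_last (x : Euc (n + 1)) :
    ⟪EuclideanSpace.single (Fin.last n) (1 : ℝ), x⟫ = x (Fin.last n) := by
  simp [EuclideanSpace.inner_single_left]

lemma norm_single_last : ‖EuclideanSpace.single (Fin.last n) (1 : ℝ)‖ = 1 := by
  simp

lemma isOpen_lower {Ω : Set (Euc (n + 1))} (hΩ : IsOpen Ω) :
    IsOpen (Ω ∩ {x | x (Fin.last n) < 0}) := by
  have h : Continuous fun x : Euc (n + 1) => x (Fin.last n) := by fun_prop
  exact hΩ.inter (isOpen_lt h continuous_const)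

lemma isOpen_upper {Ω : Set (Euc (n + 1))} (hΩ : IsOpen Ω) :
    IsOpen (Ω ∩ {x | 0 < x (Fin.last n)}) := by
  have h : Continuous fun x : Euc (n + 1) => x (Fin.last n) := by fun_prop
  exact hΩ.inter (isOpen_lt continuous_const h)

lemma norm_le_of_superjet_lower {Ω : Set (Euc (n + 1))} (hΩ : IsOpen Ω) {u : Euc (n + 1) → ℝ}
    {K : NNReal} (hK : LipschitzOnWith K u (Ω ∩ {x | x (Fin.last n) < 0})) {x b : Euc (n + 1)}
    {T : Euc (n + 1) →L[ℝ] Euc (n + 1)} (hx : x ∈ Ω ∩ {x | x (Fin.last n) < 0})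
    (hj : Superjet u x b T) : ‖b‖ ≤ K := by
  refine norm_le_of_superjet_of_lipschitz K.coe_nonneg hj ?_
  filter_upwards [(isOpen_lower hΩ).mem_nhds hx] with y hy
  have := hK.dist_le_mul y hy x hx
  rwa [Real.dist_eq, dist_eq_norm] at this

lemma normalLip_of_lipschitzOnWith {Ω : Set (Euc (n + 1))} {u : Euc (n + 1) → ℝ}
    (hu : Continuous u) {K : NNReal}
    (hK : LipschitzOnWith K u (Ω ∩ {x | x (Fin.last n) < 0})) {z : Euc (n + 1)} {r : ℝ}
    (hz : z (Fin.last n) = 0) (hr : ball z r ⊆ Ω) :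
    NormalLip (EuclideanSpace.single (Fin.last n) (1 : ℝ)) K (ball z r) u := by
  intro x hx ht
  obtain ⟨e, he⟩ : ∃ e : Euc (n + 1), e = EuclideanSpace.single (Fin.last n) (1 : ℝ) := ⟨_, rfl⟩
  have hn : ‖e‖ = 1 := by rw [he]; exact norm_single_last
  have hin : ∀ y, ⟪e, y⟫ = y (Fin.last n) := by rw [he]; exact inner_single_last
  rw [← he] at ht ⊢
  rcases ht.eq_or_lt with h0 | hlt
  · simp [h0]
  have hP : x - ⟪e, x⟫ • e ∈ ball z r := by
    rw [mem_ball, dist_eq_norm] at hx ⊢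
    have h1 := norm_sub_inner_smul_le hn (x - z)
    rw [inner_sub_right, hin z, hz, sub_zero] at h1
    have e1 : x - ⟪e, x⟫ • e - z = x - z - ⟪e, x⟫ • e := by abel
    rw [e1]; exact h1.trans_lt hx
  have hcl : x - ⟪e, x⟫ • e ∈ closure (Ω ∩ {x | x (Fin.last n) < 0}) := by
    have hc : Continuous fun s : ℝ => x - ⟪e, x⟫ • e - s • e := by fun_prop
    have ht := hc.tendsto 0
    simp only [zero_smul, sub_zero] at ht
    refine mem_closure_of_tendsto (ht.mono_left (nhdsWithin_le_nhds (s := Ioi 0))) ?_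
    filter_upwards [(ht.mono_left nhdsWithin_le_nhds).eventually (isOpen_ball.mem_nhds hP),
      self_mem_nhdsWithin] with s hs1 hs2
    refine ⟨hr hs1, ?_⟩
    change (x - ⟪e, x⟫ • e - s • e) (Fin.last n) < 0
    rw [← hin, inner_sub_right, inner_sub_inner_smul hn, real_inner_smul_right,
      inner_self_unit hn]
    have : 0 < s := hs2
    linarith
  have hxm : x ∈ Ω ∩ {x | x (Fin.last n) < 0} := by
    refine ⟨hr hx, ?_⟩
    change x (Fin.last n) < 0
    rw [← hin]; exact hlt
  have := (hK.closure hu.continuousOn).dist_le_mul x (subset_closure hxm) _ hcl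
  rwa [Real.dist_eq, dist_eq_norm, sub_sub_cancel, norm_smul, hn, mul_one, Real.norm_eq_abs,
    abs_of_neg hlt] at this

end LipschitzBelow

theorem statement_4 {n : ℕ} (lam Lam η : ℝ) (hlam : 0 < lam) (hLam : lam ≤ Lam)
    (hη : 0 < η)
    (Ω Ωm Ωp Γ : Set (Euc (n + 1)))
    (hΩ : IsOpen Ω) (hΩb : Bornology.IsBounded Ω)
    (hΩm : Ωm = Ω ∩ {x | x (Fin.last n) < 0})
    (hΩp : Ωp = Ω ∩ {x | 0 < x (Fin.last n)})
    (hΓ : Γ = Ω ∩ {x | x (Fin.last n) = 0})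
    (Hm : Euc (n + 1) → ℝ → Euc (n + 1) → ℝ)
    (hHmLip : LocallyLipschitzOp1 (Ωm ∪ Γ) Hm)
    (hHmDE : DegElliptic1 (Ωm ∪ Γ) Hm)
    (hHmQC : QuasiConvex1 (Ωm ∪ Γ) Hm)
    (hHmBS : BoundedSublevels1 (Ωm ∪ Γ) Hm)
    (Hp : Matrix (Fin (n + 1)) (Fin (n + 1)) ℝ → Euc (n + 1) → ℝ → Euc (n + 1) → ℝ)
    (F : Matrix (Fin (n + 1)) (Fin (n + 1)) ℝ → Euc (n + 1) → ℝ → ℝ)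
    (f : ℝ → Euc (n + 1) → ℝ)
    (hHp : ∀ M p z x, Hp M p z x = F M p z + f z x)
    (hHpDE : DegElliptic2 (Ωp ∪ Γ) Hp)
    (hFC : Continuous fun q : Matrix (Fin (n + 1)) (Fin (n + 1)) ℝ × Euc (n + 1) × ℝ =>
      F q.1 q.2.1 q.2.2)
    (hFUE : UnifEllipticF lam Lam F)
    (hfC : ContinuousOn (fun q : ℝ × Euc (n + 1) => f q.1 q.2) (univ ×ˢ (Ωp ∪ Γ)))
    (hfInc : ∀ x ∈ Ωp ∪ Γ, ∀ z₁ z₂ : ℝ, z₁ < z₂ → f z₁ x < f z₂ x)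
    (u v : Euc (n + 1) → ℝ)
    (huC : ContinuousOn u (closure Ω)) (hvC : ContinuousOn v (closure Ω))
    (huLip : ∃ K : NNReal, LipschitzOnWith K u Ωm)
    (hvLip : ∃ K : NNReal, LipschitzOnWith K v Ωm)
    (husub : ∀ x₀ : Euc (n + 1), ∀ φ : Euc (n + 1) → ℝ, ∀ r : ℝ, SubTest Ω u x₀ φ r →
      (x₀ ∈ Ωm ∪ Γ → evalOp1 Hm φ x₀ + η ≤ 0) ∧ (x₀ ∈ Ωp → evalOp2 Hp φ x₀ + η ≤ 0))
    (hvsup : ∀ x₀ : Euc (n + 1), ∀ φ : Euc (n + 1) → ℝ, ∀ r : ℝ, SupTest Ω v x₀ φ r →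
      (x₀ ∈ Ωm ∪ Γ → 0 ≤ evalOp1 Hm φ x₀) ∧ (x₀ ∈ Ωp → 0 ≤ evalOp2 Hp φ x₀))
    (hbdry : ∀ x ∈ frontier Ω, u x ≤ v x) :
    ∀ x ∈ Ω, u x ≤ v x := by
  by_contra! hcon
  obtain ⟨x₁, hx₁, hlt⟩ := hcon
  obtain ⟨Ku, hKu⟩ := huLip
  obtain ⟨Kv, hKv⟩ := hvLip
  obtain ⟨u', hu'c, hu'⟩ := exists_continuous_extension isClosed_closure huC
  obtain ⟨v', hv'c, hv'⟩ := exists_continuous_extension isClosed_closure hvC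
  have hclo : Ω ⊆ closure Ω := subset_closure
  obtain ⟨z, hz, hzmax⟩ := hΩb.isCompact_closure.exists_isMaxOn ⟨x₁, hclo hx₁⟩
    (hu'c.sub hv'c).continuousOn
  have hzmax' : ∀ y ∈ closure Ω, u' y - v' y ≤ u' z - v' z := fun y hy => hzmax hy
  have hzpos : v' z < u' z := by
    have := hzmax' x₁ (hclo hx₁)
    rw [hu' (hclo hx₁), hv' (hclo hx₁)] at this
    linarith
  have hzΩ : z ∈ Ω := by
    by_contra hzn
    have hzf : z ∈ frontier Ω := by rw [hΩ.frontier_eq]; exact ⟨hz, hzn⟩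
    have := hbdry z hzf
    rw [← hu' hz, ← hv' hz] at this
    linarith
  have hmc : Ωm ⊆ closure Ω := by rw [hΩm]; exact inter_subset_left.trans subset_closure
  have hu'm : LipschitzOnWith Ku u' (Ω ∩ {x | x (Fin.last n) < 0}) := by
    rw [← hΩm]
    intro x hx y hy
    rw [hu' (hmc hx), hu' (hmc hy)]
    exact hKu hx hy
  have hv'm : LipschitzOnWith Kv v' (Ω ∩ {x | x (Fin.last n) < 0}) := by
    rw [← hΩm]
    intro x hx y hy
    rw [hv' (hmc hx), hv' (hmc hy)]
    exact hKv hx hy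
  have hw'm : LipschitzOnWith Kv (fun y => -v' y) (Ω ∩ {x | x (Fin.last n) < 0}) := hv'm.neg
  have hJu : ∀ x ∈ Ω, ∀ b T, Superjet u' x b T →
      (x ∈ Ωm ∪ Γ → Hm b (u' x) x + η ≤ 0) ∧
        (x ∈ Ωp → F (formMatrix T) b (u' x) + f (u' x) x + η ≤ 0) := by
    intro x hx b T hj
    have heq : u' =ᶠ[𝓝 x] u := by
      filter_upwards [hΩ.mem_nhds hx] with y hy using hu' (hclo hy)
    obtain ⟨r, hr⟩ := exists_subTest hΩ hx (hj.congr heq)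
    have := husub x _ r hr
    simp only [evalOp1, evalOp2, gradient_quadPoly _ _ _ hj.1, hessianMatrix_quadPoly _ _ _ hj.1,
      quadPoly_self, hHp] at this
    rwa [hu' (hclo hx)]
  have hJw : ∀ x ∈ Ω, ∀ b T, Superjet (fun y => -v' y) x b T →
      (x ∈ Ωm ∪ Γ → 0 ≤ Hm (-b) (v' x) x) ∧
        (x ∈ Ωp → 0 ≤ F (formMatrix (-T)) (-b) (v' x) + f (v' x) x) := by
    intro x hx b T hj
    have heq : (fun y => -v' y) =ᶠ[𝓝 x] fun y => -v y := by
      filter_upwards [hΩ.mem_nhds hx] with y hy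
      rw [hv' (hclo hy)]
    have hT : ∀ y z, ⟪(-T) y, z⟫ = ⟪y, (-T) z⟫ := by
      intro y z
      rw [neg_apply, neg_apply, inner_neg_left, inner_neg_right, hj.1]
    obtain ⟨r, hr⟩ := exists_supTest hΩ hx (hj.congr heq)
    have := hvsup x _ r hr
    simp only [evalOp1, evalOp2, gradient_quadPoly _ _ _ hT, hessianMatrix_quadPoly _ _ _ hT,
      quadPoly_self, hHp] at this
    rwa [hv' (hclo hx)]
  obtain ⟨R, hR⟩ : ∃ R : ℝ, R = max Ku Kv := ⟨_, rfl⟩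
  have hRu : (Ku : ℝ) ≤ R := by rw [hR]; exact_mod_cast le_max_left _ _
  have hRv : (Kv : ℝ) ≤ R := by rw [hR]; exact_mod_cast le_max_right _ _
  have hLam0 : 0 < Lam := hlam.trans_le hLam
  obtain ⟨h, hh⟩ : ∃ h : Euc (n + 1) → ℝ, h = fun b => Hm b (v' z) z := ⟨_, rfl⟩
  obtain ⟨G, hG⟩ : ∃ G : (Euc (n + 1) →L[ℝ] Euc (n + 1)) → Euc (n + 1) → ℝ,
    G = fun T b => F (formMatrix T) b (v' z) + f (v' z) z := ⟨_, rfl⟩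
  have hGell : Ell (EuclideanSpace.single (Fin.last n) (1 : ℝ)) lam (Lam * (n + 1 : ℕ)) G := by
    rw [hG]; exact hFUE.ell hlam hLam _ _ _
  have hL0 : 0 ≤ Lam * ((n + 1 : ℕ) : ℝ) := by positivity
  have hzu : ∀ᶠ y in 𝓝 z, v' z < u' y := (hu'c.tendsto z).eventually_const_lt hzpos
  have hΩz : ∀ᶠ y in 𝓝 z, y ∈ Ω := hΩ.mem_nhds hzΩ
  have hmu : z ∈ Ωm ∪ Γ → ∀ᶠ y in 𝓝 z, ∀ b T, Superjet u' y b T → y ∈ Ωm ∪ Γ →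
      ‖b‖ ≤ R + 2 → h b ≤ -(3 * η / 4) := by
    intro hzS
    filter_upwards [hΩz, hzu, hHmLip.eventually_close hzS (continuous_const (y := v' z)) (R + 2)
      (by positivity : 0 < η / 4)] with y k1 k2 k3 b T hj hy hb
    have m1 := (hJu y k1 b T hj).1 hy
    have m2 := hHmDE b _ _ y hy k2.le
    have m3 := k3 b (by simpa using hb) hy
    rw [abs_lt] at m3
    rw [hh]
    simp only
    linarith [m3.1]
  have hmw : z ∈ Ωm ∪ Γ → ∀ᶠ y in 𝓝 z, ∀ b T, Superjet (fun y => -v' y) y b T → y ∈ Ωm ∪ Γ →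
      ‖b‖ ≤ R + 2 → -(η / 4) ≤ h (-b) := by
    intro hzS
    filter_upwards [hΩz, hHmLip.eventually_close hzS hv'c (R + 2)
      (by positivity : 0 < η / 4)] with y k1 k3 b T hj hy hb
    have m1 := (hJw y k1 b T hj).1 hy
    have m3 := k3 (-b) (by simpa using hb) hy
    rw [abs_lt] at m3
    rw [hh]
    simp only
    linarith [m3.2]
  have hpu : z ∈ Ωp ∪ Γ → ∀ᶠ y in 𝓝 z, ∀ b T, Superjet u' y b T → y ∈ Ωp →
      G T b ≤ -(3 * η / 4) := by
    intro hzS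
    filter_upwards [hΩz, hzu, eventually_close_of_continuousOn hfC hzS
      (continuous_const (y := v' z)) (by positivity : 0 < η / 4)] with y k1 k2 k3 b T hj hy
    have m1 := (hJu y k1 b T hj).2 hy
    have m2 := hFUE.mono hLam (formMatrix T) b k2.le
    have m3 := k3 (Or.inl hy)
    have m4 := hfInc y (Or.inl hy) _ _ k2
    rw [abs_lt] at m3
    rw [hG]
    simp only
    linarith [m3.1]
  have hpw : z ∈ Ωp ∪ Γ → ∀ᶠ y in 𝓝 z, ∀ b T, Superjet (fun y => -v' y) y b T → y ∈ Ωp →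
      -(η / 4) ≤ G (-T) (-b) := by
    intro hzS
    have hc : Continuous fun y => Lam * max (v' y - v' z) 0 := by fun_prop
    have hsm : ∀ᶠ y in 𝓝 z, Lam * max (v' y - v' z) 0 < η / 8 := by
      refine (hc.tendsto z).eventually_lt_const ?_
      simpa using hη
    filter_upwards [hΩz, hsm, eventually_close_of_continuousOn hfC hzS hv'c
      (by positivity : 0 < η / 8)] with y k1 k2 k3 b T hj hy
    have m1 := (hJw y k1 b T hj).2 hy
    have m2 := hFUE.le_add hLam (formMatrix (-T)) (-b) (v' z) (v' y)
    have m3 := k3 (Or.inl hy)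
    rw [abs_lt] at m3
    rw [hG]
    simp only
    linarith [m3.2]
  have hmax : ∀ y ∈ Ω, u' y + -v' y ≤ u' z + -v' z := fun y hy => by
    linarith [hzmax' y (hclo hy)]
  suffices hfin : -(η / 4) ≤ -(3 * η / 4) by linarith
  rcases lt_trichotomy (z (Fin.last n)) 0 with ht | ht | ht
  · have hzm : z ∈ Ωm := by rw [hΩm]; exact ⟨hzΩ, ht⟩
    have hmo : ∀ᶠ y in 𝓝 z, y ∈ Ωm := by
      rw [hΩm] at hzm ⊢; exact (isOpen_lower hΩ).mem_nhds hzm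
    obtain ⟨r, hr, hball⟩ := Metric.eventually_nhds_iff.1
      (hmo.and ((hmu (Or.inl hzm)).and (hmw (Or.inl hzm))))
    refine firstOrder_interior (z := z) (r := r / 2) (R := R) (h := h) hu'c hv'c.neg (by positivity)
      (by rw [hh]; exact hHmLip.continuous_left (Or.inl hzm) _) ?_ ?_ ?_
    · intro y hy
      have := (hball (lt_of_le_of_lt (mem_closedBall.1 hy) (by linarith))).1
      rw [hΩm] at this
      exact hmax y this.1
    · intro y hy b T hj
      obtain ⟨k1, k2, -⟩ := hball (lt_trans (mem_ball.1 hy) (by linarith))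
      have hb : ‖b‖ ≤ Ku := norm_le_of_superjet_lower hΩ hu'm (by rwa [hΩm] at k1) hj
      exact ⟨hb.trans hRu, k2 b T hj (Or.inl k1) (by linarith)⟩
    · intro y hy b T hj
      obtain ⟨k1, -, k2⟩ := hball (lt_trans (mem_ball.1 hy) (by linarith))
      have hb : ‖b‖ ≤ Kv := norm_le_of_superjet_lower hΩ hw'm (by rwa [hΩm] at k1) hj
      exact k2 b T hj (Or.inl k1) (by linarith)
  · have hzΓ : z ∈ Γ := by rw [hΓ]; exact ⟨hzΩ, ht⟩
    obtain ⟨r, hr, hball⟩ := Metric.eventually_nhds_iff.1 (hΩz.and (((hmu (Or.inr hzΓ)).and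
      (hmw (Or.inr hzΓ))).and ((hpu (Or.inr hzΓ)).and (hpw (Or.inr hzΓ)))))
    have hsub : ball z (r / 2) ⊆ Ω := fun y hy =>
      (hball (lt_trans (mem_ball.1 hy) (by linarith))).1
    refine interface_comparison (z := z) (ρ := r / 2) (R := R) (h := h) (G := G) norm_single_last
      hu'c hv'c.neg (by rw [inner_single_last, ht]) (by positivity) hlam hL0
      (by rw [hh]; exact hHmLip.continuous_left (Or.inr hzΓ) _) hGell ?_ ?_ ?_
      (normalLip_of_lipschitzOnWith hu'c hu'm ht hsub)
      (normalLip_of_lipschitzOnWith hv'c.neg hw'm ht hsub)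
    · intro y hy
      exact hmax y (hball (lt_of_le_of_lt (mem_closedBall.1 hy) (by linarith))).1
    · intro y hy b T hj
      obtain ⟨k0, ⟨k1, -⟩, k2, -⟩ := hball (lt_trans (mem_ball.1 hy) (by linarith))
      rw [inner_single_last]
      refine ⟨fun hs => ?_, fun hs hb => ?_, fun hs => ?_⟩
      · have hb : ‖b‖ ≤ Ku := norm_le_of_superjet_lower hΩ hu'm ⟨k0, hs⟩ hj
        exact ⟨hb.trans hRu, k1 b T hj (Or.inl (by rw [hΩm]; exact ⟨k0, hs⟩)) (by linarith)⟩
      · exact k1 b T hj (Or.inr (by rw [hΓ]; exact ⟨k0, hs⟩)) hb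
      · exact k2 b T hj (by rw [hΩp]; exact ⟨k0, hs⟩)
    · intro y hy b T hj
      obtain ⟨k0, ⟨-, k1⟩, -, k2⟩ := hball (lt_trans (mem_ball.1 hy) (by linarith))
      rw [inner_single_last]
      refine ⟨fun hs => ?_, fun hs hb => ?_, fun hs => ?_⟩
      · have hb : ‖b‖ ≤ Kv := norm_le_of_superjet_lower hΩ hw'm ⟨k0, hs⟩ hj
        exact ⟨hb.trans hRv, neg_le_neg
          (k1 b T hj (Or.inl (by rw [hΩm]; exact ⟨k0, hs⟩)) (by linarith))⟩
      · exact neg_le_neg (k1 b T hj (Or.inr (by rw [hΓ]; exact ⟨k0, hs⟩)) hb)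
      · exact neg_le_neg (k2 b T hj (by rw [hΩp]; exact ⟨k0, hs⟩))
  · have hzp : z ∈ Ωp := by rw [hΩp]; exact ⟨hzΩ, ht⟩
    have hpo : ∀ᶠ y in 𝓝 z, y ∈ Ωp := by
      rw [hΩp] at hzp ⊢; exact (isOpen_upper hΩ).mem_nhds hzp
    obtain ⟨r, hr, hball⟩ := Metric.eventually_nhds_iff.1
      (hpo.and ((hpu (Or.inl hzp)).and (hpw (Or.inl hzp))))
    refine secondOrder_interior (z := z) (r := r / 2) (G := G) hu'c hv'c.neg (by positivity) hL0
      hGell ?_ ?_ ?_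
    · intro y hy
      have := (hball (lt_of_le_of_lt (mem_closedBall.1 hy) (by linarith))).1
      rw [hΩp] at this
      exact hmax y this.1
    · intro y hy b T hj
      obtain ⟨k1, k2, -⟩ := hball (lt_trans (mem_ball.1 hy) (by linarith))
      exact k2 b T hj k1
    · intro y hy b T hj
      obtain ⟨k1, -, k2⟩ := hball (lt_trans (mem_ball.1 hy) (by linarith))
      exact k2 b T hj k1

end
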